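/- Suppose N ≥ 5 and 1 ≤ k < (N-2)/2. There is a fixed constant θ > 0 such that for any ε ∈ (0,1) there exist a constant C_ε > 0 depending on ε and a constant C > 0 independent of ε, such that for all y ∈ Ω: ∫_Ω G(z,y)(Σ_{j=0}^∞ U_{x_j,μ}(z))^{4/(N-2)} σ(z) Σ_{j=0}^∞ μ^{(N-2)/2}(1+μ|z-x_j|)^{-((N-2)/2+τ)} dz ≤ C_ε σ(y) Σ_{j=0}^∞ μ^{(N-2)/2}(1+μ|y-x_j|)^{-((N-2)/2+τ+θ)} + C ε^{2-4τ/(N-2)} μ^{-(2-4τ/(N-2))} σ(y) Σ_{j=0}^∞ μ^{(N-2)/2}(1+μ|y-x_j|)^{-((N-2)/2+τ)}. -/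

import Mathlib

open Real MeasureTheory Filter Topology
open scoped Classical

noncomputable section

namespace PeriodicCriticalSystem

/-- Euclidean space `ℝ^N`. -/
abbrev Euc (N : ℕ) : Type := EuclideanSpace ℝ (Fin N)

/-- The `i`-th standard coordinate vector `e_i`. -/
def e (N : ℕ) (i : Fin N) : Euc N := EuclideanSpace.single i 1

/-- The strip `Ω = {y : |y_i| ≤ L/2, i = 1,…,k}`. -/
def strip (N k : ℕ) (L : ℝ) : Set (Euc N) :=
  {y : Euc N | ∀ i : Fin N, (i : ℕ) < k → |y i| ≤ L / 2}

/-- The `i`-th partial derivative. -/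
def pd {N : ℕ} (i : Fin N) (u : Euc N → ℝ) (y : Euc N) : ℝ := fderiv ℝ u y (e N i)

/-- The Laplacian `Δu = Σ_i ∂²u/∂y_i²`. -/
def lap {N : ℕ} (u : Euc N → ℝ) (y : Euc N) : ℝ :=
  ∑ i : Fin N, iteratedDeriv 2 (fun t : ℝ => u (y + t • e N i)) 0

/-- The norm `|y''|` of the last `N - k` coordinates. -/
def tailNorm {N : ℕ} (k : ℕ) (y : Euc N) : ℝ :=
  Real.sqrt (∑ i : Fin N, if k ≤ (i : ℕ) then (y i) ^ 2 else 0)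

/-- The periodic boundary conditions on the strip, together with decay as `|y''| → ∞`. -/
structure PeriodicBC (N k : ℕ) (L : ℝ) (u : Euc N → ℝ) : Prop where
  per : ∀ i : Fin N, (i : ℕ) < k → ∀ y : Euc N, y i = -(L / 2) → u (y + L • e N i) = u y
  per_deriv : ∀ i : Fin N, (i : ℕ) < k → ∀ y : Euc N, y i = -(L / 2) →
    pd i u (y + L • e N i) = pd i u y
  decay : ∀ ε : ℝ, 0 < ε → ∃ R : ℝ, ∀ y ∈ strip N k L, R ≤ tailNorm k y → |u y| < ε

/-- The critical Sobolev exponent `2* = 2N/(N-2)`. -/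
def tS (N : ℕ) : ℝ := 2 * (N : ℝ) / ((N : ℝ) - 2)

/-- Conditions (A₁) and (A₂) on a coefficient function `K`. -/
structure CondA (N k : ℕ) (K : Euc N → ℝ) (a β : Fin N → ℝ) (βm βM σ : ℝ) : Prop where
  periodic : ∀ i : Fin N, (i : ℕ) < k → ∀ y : Euc N, K (y + e N i) = K y
  bounded : ∃ M : ℝ, ∀ y : Euc N, |K y| ≤ M
  a_ne : ∀ i : Fin N, a i ≠ 0
  β_gt : ∀ i : Fin N, (N : ℝ) - 2 < β i
  β_lt : ∀ i : Fin N, β i < (N : ℝ)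
  βm_le : ∀ i : Fin N, βm ≤ β i
  βm_mem : ∃ i : Fin N, β i = βm
  le_βM : ∀ i : Fin N, β i ≤ βM
  βM_mem : ∃ i : Fin N, β i = βM
  βM_le : βM ≤ βm * (1 + 1 / ((N : ℝ) - 2))
  σ_pos : 0 < σ
  expansion : ∃ δ C : ℝ, 0 < δ ∧ 0 < C ∧ ∀ x : Euc N, ‖x‖ < δ →
    |K x - 1 - ∑ i : Fin N, a i * |x i| ^ (β i)| ≤ C * ‖x‖ ^ (βM + σ)
  neg_sum : (∑ i ∈ Finset.univ.filter (fun i => β i = βm), a i) < 0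

/-- The standard bubble `W_{x,μ}`. -/
def Wb (N : ℕ) (x : Euc N) (μ : ℝ) (y : Euc N) : ℝ :=
  ((N : ℝ) * ((N : ℝ) - 2)) ^ (((N : ℝ) - 2) / 4) * μ ^ (((N : ℝ) - 2) / 2) /
    (1 + μ ^ 2 * ‖y - x‖ ^ 2) ^ (((N : ℝ) - 2) / 2)

/-- The synchronized bubble `U_{x,μ} = s W_{x,μ}`. -/
def Ub (N : ℕ) (s : ℝ) (x : Euc N) (μ : ℝ) (y : Euc N) : ℝ := s * Wb N x μ y

/-- The synchronized bubble `V_{x,μ} = κ s W_{x,μ}`. -/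
def Vb (N : ℕ) (s κ : ℝ) (x : Euc N) (μ : ℝ) (y : Euc N) : ℝ := κ * s * Wb N x μ y

/-- The algebraic relations defining the synchronization constants `s` and `κ`. -/
def SyncConst (N : ℕ) (s κ : ℝ) : Prop :=
  0 < s ∧ 0 < κ ∧ s ^ (tS N - 2) = 2 / (2 + κ ^ (tS N / 2)) ∧
    2 + κ ^ (tS N / 2) - κ ^ (tS N / 2 - 1) - 2 * κ ^ (tS N - 1) = 0

/-- The lattice `Q_k` of integer points in the first `k` coordinates. -/
def Qlat (N k : ℕ) : Set (Euc N) :=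
  {y : Euc N | (∀ i : Fin N, ∃ m : ℤ, y i = (m : ℝ)) ∧ ∀ i : Fin N, k ≤ (i : ℕ) → y i = 0}

/-- `P` enumerates the lattice `Q_k` with `P 0 = 0`. -/
def LatticeEnum (N k : ℕ) (P : ℕ → Euc N) : Prop :=
  Function.Injective P ∧ Set.range P = Qlat N k ∧ P 0 = 0

/-- The area `ω_{N-1}` of the unit sphere `S^{N-1}`. -/
def sphereArea (N : ℕ) : ℝ := (N : ℝ) * (volume (Metric.ball (0 : Euc N) 1)).toReal

/-- The fundamental solution `Γ(y,z)` of `-Δ`. -/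
def Γfun (N : ℕ) (y z : Euc N) : ℝ :=
  1 / (((N : ℝ) - 2) * sphereArea N * ‖y - z‖ ^ ((N : ℝ) - 2))

/-- The Green's function of `-Δ` on the strip with periodic boundary conditions. -/
def Green (N : ℕ) (L : ℝ) (P : ℕ → Euc N) (y z : Euc N) : ℝ :=
  ∑' j : ℕ, Γfun N (y + L • P j) z

/-- The projected bubble `PU_{x,μ}`. -/
def PU (N k : ℕ) (L : ℝ) (P : ℕ → Euc N) (s κ : ℝ) (x : Euc N) (μ : ℝ) (y : Euc N) : ℝ :=
  ∫ z in strip N k L, Green N L P y z *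
    (Ub N s x μ z ^ (tS N - 1) +
      (1 / 2) * Ub N s x μ z ^ (tS N / 2 - 1) * Vb N s κ x μ z ^ (tS N / 2))

/-- The projected bubble `PV_{x,μ}`. -/
def PV (N k : ℕ) (L : ℝ) (P : ℕ → Euc N) (s κ : ℝ) (x : Euc N) (μ : ℝ) (y : Euc N) : ℝ :=
  ∫ z in strip N k L, Green N L P y z *
    (Vb N s κ x μ z ^ (tS N - 1) +
      (1 / 2) * Vb N s κ x μ z ^ (tS N / 2 - 1) * Ub N s x μ z ^ (tS N / 2))

/-- The translated centers `x_j = x - L P_j`. -/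
def xc {N : ℕ} (L : ℝ) (P : ℕ → Euc N) (x : Euc N) (j : ℕ) : Euc N := x - L • P j

/-- The extra weight `σ(y)`. -/
def σw {N : ℕ} (x : Euc N) (μ τ : ℝ) (y : Euc N) : ℝ :=
  min 1 (((1 + μ * ‖y - x‖) / μ) ^ (τ - 1))

/-- The weight defining the `*` norm. -/
def wStar (N : ℕ) (L : ℝ) (P : ℕ → Euc N) (x : Euc N) (μ τ : ℝ) (y : Euc N) : ℝ :=
  σw x μ τ y *
    ∑' j : ℕ, μ ^ (((N : ℝ) - 2) / 2) / (1 + μ * ‖y - xc L P x j‖) ^ (((N : ℝ) - 2) / 2 + τ)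

/-- The weight defining the `**` norm. -/
def wStarStar (N : ℕ) (L : ℝ) (P : ℕ → Euc N) (x : Euc N) (μ τ : ℝ) (y : Euc N) : ℝ :=
  σw x μ τ y *
    ∑' j : ℕ, μ ^ (((N : ℝ) + 2) / 2) / (1 + μ * ‖y - xc L P x j‖) ^ (((N : ℝ) + 2) / 2 + τ)

/-- The `*` norm. -/
def normStar (N k : ℕ) (L : ℝ) (P : ℕ → Euc N) (x : Euc N) (μ τ : ℝ) (u : Euc N → ℝ) : ℝ :=
  sSup ((fun y => |u y| / wStar N L P x μ τ y) '' strip N k L)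

/-- The `**` norm. -/
def normStarStar (N k : ℕ) (L : ℝ) (P : ℕ → Euc N) (x : Euc N) (μ τ : ℝ) (f : Euc N → ℝ) : ℝ :=
  sSup ((fun y => |f y| / wStarStar N L P x μ τ y) '' strip N k L)

/-- Finiteness of the `*` norm. -/
def FiniteStar (N k : ℕ) (L : ℝ) (P : ℕ → Euc N) (x : Euc N) (μ τ : ℝ) (u : Euc N → ℝ) : Prop :=
  BddAbove ((fun y => |u y| / wStar N L P x μ τ y) '' strip N k L)

/-- Finiteness of the `**` norm. -/
def FiniteStarStar (N k : ℕ) (L : ℝ) (P : ℕ → Euc N) (x : Euc N) (μ τ : ℝ)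
    (f : Euc N → ℝ) : Prop :=
  BddAbove ((fun y => |f y| / wStarStar N L P x μ τ y) '' strip N k L)

/-- Membership of a pair in the space `X`. -/
def MemX (N k : ℕ) (L : ℝ) (P : ℕ → Euc N) (x : Euc N) (μ τ : ℝ) (u v : Euc N → ℝ) : Prop :=
  PeriodicBC N k L u ∧ PeriodicBC N k L v ∧
    FiniteStar N k L P x μ τ u ∧ FiniteStar N k L P x μ τ v

/-- Membership of a pair in the space `Y`. -/
def MemY (N k : ℕ) (L : ℝ) (P : ℕ → Euc N) (x : Euc N) (μ τ : ℝ) (f g : Euc N → ℝ) : Prop :=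
  FiniteStarStar N k L P x μ τ f ∧ FiniteStarStar N k L P x μ τ g

/-- The operator `(-Δ)^{-1}` given by the Green's function. -/
def invLap (N k : ℕ) (L : ℝ) (P : ℕ → Euc N) (f : Euc N → ℝ) (y : Euc N) : ℝ :=
  ∫ z in strip N k L, Green N L P z y * f z

/-- `Y_h`: derivatives of `U_{x,μ}` in `x_h` (`h < N`) and in `μ` (`h = N+1`). -/
def Yd (N : ℕ) (s : ℝ) (x : Euc N) (μ : ℝ) (h : Fin (N + 1)) (y : Euc N) : ℝ :=
  if hh : (h : ℕ) < N then fderiv ℝ (fun x' => Ub N s x' μ y) x (e N ⟨(h : ℕ), hh⟩)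
  else deriv (fun μ' => Ub N s x μ' y) μ

/-- `Z_h`: derivatives of `V_{x,μ}`. -/
def Zd (N : ℕ) (s κ : ℝ) (x : Euc N) (μ : ℝ) (h : Fin (N + 1)) (y : Euc N) : ℝ :=
  if hh : (h : ℕ) < N then fderiv ℝ (fun x' => Vb N s κ x' μ y) x (e N ⟨(h : ℕ), hh⟩)
  else deriv (fun μ' => Vb N s κ x μ' y) μ

/-- `∂_h PU_{x,μ}`. -/
def dPU (N k : ℕ) (L : ℝ) (P : ℕ → Euc N) (s κ : ℝ) (x : Euc N) (μ : ℝ) (h : Fin (N + 1))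
    (y : Euc N) : ℝ :=
  if hh : (h : ℕ) < N then fderiv ℝ (fun x' => PU N k L P s κ x' μ y) x (e N ⟨(h : ℕ), hh⟩)
  else deriv (fun μ' => PU N k L P s κ x μ' y) μ

/-- `∂_h PV_{x,μ}`. -/
def dPV (N k : ℕ) (L : ℝ) (P : ℕ → Euc N) (s κ : ℝ) (x : Euc N) (μ : ℝ) (h : Fin (N + 1))
    (y : Euc N) : ℝ :=
  if hh : (h : ℕ) < N then fderiv ℝ (fun x' => PV N k L P s κ x' μ y) x (e N ⟨(h : ℕ), hh⟩)
  else deriv (fun μ' => PV N k L P s κ x μ' y) μ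

/-- `α(h) = 1` for `h = 1,…,N` and `α(N+1) = -1`. -/
def αe (N : ℕ) (h : Fin (N + 1)) : ℝ := if (h : ℕ) < N then 1 else -1

/-- Membership of a pair in the space `E`. -/
def MemE (N k : ℕ) (L : ℝ) (P : ℕ → Euc N) (s κ : ℝ) (x : Euc N) (μ τ : ℝ)
    (u v : Euc N → ℝ) : Prop :=
  MemX N k L P x μ τ u v ∧
    (∀ h : Fin (N + 1),
      (∫ y in strip N k L, u y * Ub N s x μ y ^ (tS N - 2) * Yd N s x μ h y) = 0) ∧
    (∀ h : Fin (N + 1),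
      (∫ y in strip N k L, v y * Vb N s κ x μ y ^ (tS N - 2) * Zd N s κ x μ h y) = 0)

/-- Membership of a pair in the space `F`. -/
def MemF (N k : ℕ) (L : ℝ) (P : ℕ → Euc N) (s κ : ℝ) (x : Euc N) (μ : ℝ)
    (f g : Euc N → ℝ) : Prop :=
  (∀ h : Fin (N + 1), (∫ y in strip N k L, f y * dPU N k L P s κ x μ h y) = 0) ∧
  (∀ h : Fin (N + 1), (∫ y in strip N k L, g y * dPV N k L P s κ x μ h y) = 0)

/-- The admissible range of the parameters `(x, μ)` relative to `L`. -/
def Admissible (N : ℕ) (θ C0 β : ℝ) (L : ℝ) (x : Euc N) (μ : ℝ) : Prop :=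
  1 ≤ μ ∧ 1 ≤ L ∧ ‖x‖ ≤ μ ^ (-(1 + θ)) ∧
    μ * L ^ (-(((N : ℝ) - 2) / (β - ((N : ℝ) - 2)))) ∈ Set.Icc (C0 / 2) (2 * C0)

/-- First component of the linearized operator. -/
def lin1 (N k : ℕ) (L : ℝ) (P : ℕ → Euc N) (s κ : ℝ) (K1 : Euc N → ℝ) (x : Euc N) (μ : ℝ)
    (ω1 ω2 : Euc N → ℝ) (y : Euc N) : ℝ :=
  K1 y * PU N k L P s κ x μ y ^ (tS N - 2) * ω1 y -
    (1 / ((N : ℝ) + 2)) * PU N k L P s κ x μ y ^ ((4 - (N : ℝ)) / ((N : ℝ) - 2)) *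
      PV N k L P s κ x μ y ^ ((N : ℝ) / ((N : ℝ) - 2)) * ω1 y -
    ((N : ℝ) / (2 * ((N : ℝ) + 2))) * PU N k L P s κ x μ y ^ (2 / ((N : ℝ) - 2)) *
      PV N k L P s κ x μ y ^ (2 / ((N : ℝ) - 2)) * ω2 y

/-- Second component of the linearized operator. -/
def lin2 (N k : ℕ) (L : ℝ) (P : ℕ → Euc N) (s κ : ℝ) (K2 : Euc N → ℝ) (x : Euc N) (μ : ℝ)
    (ω1 ω2 : Euc N → ℝ) (y : Euc N) : ℝ :=
  K2 y * PV N k L P s κ x μ y ^ (tS N - 2) * ω2 y -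
    (1 / ((N : ℝ) + 2)) * PV N k L P s κ x μ y ^ ((4 - (N : ℝ)) / ((N : ℝ) - 2)) *
      PU N k L P s κ x μ y ^ ((N : ℝ) / ((N : ℝ) - 2)) * ω2 y -
    ((N : ℝ) / (2 * ((N : ℝ) + 2))) * PV N k L P s κ x μ y ^ (2 / ((N : ℝ) - 2)) *
      PU N k L P s κ x μ y ^ (2 / ((N : ℝ) - 2)) * ω1 y

/-- First component `ℓ₁` of the error term. -/
def ell1 (N k : ℕ) (L : ℝ) (P : ℕ → Euc N) (s κ : ℝ) (K1 : Euc N → ℝ) (x : Euc N) (μ : ℝ)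
    (y : Euc N) : ℝ :=
  K1 y * PU N k L P s κ x μ y ^ (tS N - 1) - Ub N s x μ y ^ (tS N - 1) -
    (1 / 2) * (Ub N s x μ y ^ (tS N / 2 - 1) * Vb N s κ x μ y ^ (tS N / 2) -
      PU N k L P s κ x μ y ^ (tS N / 2 - 1) * PV N k L P s κ x μ y ^ (tS N / 2))

/-- Second component `ℓ₂` of the error term. -/
def ell2 (N k : ℕ) (L : ℝ) (P : ℕ → Euc N) (s κ : ℝ) (K2 : Euc N → ℝ) (x : Euc N) (μ : ℝ)
    (y : Euc N) : ℝ :=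
  K2 y * PV N k L P s κ x μ y ^ (tS N - 1) - Vb N s κ x μ y ^ (tS N - 1) -
    (1 / 2) * (Vb N s κ x μ y ^ (tS N / 2 - 1) * Ub N s x μ y ^ (tS N / 2) -
      PV N k L P s κ x μ y ^ (tS N / 2 - 1) * PU N k L P s κ x μ y ^ (tS N / 2))

/-- First component `N₁` of the higher order term. -/
def Nl1 (N k : ℕ) (L : ℝ) (P : ℕ → Euc N) (s κ : ℝ) (K1 : Euc N → ℝ) (x : Euc N) (μ : ℝ)
    (ω1 ω2 : Euc N → ℝ) (y : Euc N) : ℝ :=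
  K1 y * ((max (PU N k L P s κ x μ y + ω1 y) 0) ^ (tS N - 1) -
      PU N k L P s κ x μ y ^ (tS N - 1) -
      (tS N - 1) * PU N k L P s κ x μ y ^ (tS N - 2) * ω1 y) +
    (1 / 2) * ((PU N k L P s κ x μ y + ω1 y) ^ (2 / ((N : ℝ) - 2)) *
        (PV N k L P s κ x μ y + ω2 y) ^ ((N : ℝ) / ((N : ℝ) - 2)) -
      PU N k L P s κ x μ y ^ (2 / ((N : ℝ) - 2)) *
        PV N k L P s κ x μ y ^ ((N : ℝ) / ((N : ℝ) - 2))) -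
    (1 / ((N : ℝ) - 2)) * PU N k L P s κ x μ y ^ ((4 - (N : ℝ)) / ((N : ℝ) - 2)) *
      PV N k L P s κ x μ y ^ ((N : ℝ) / ((N : ℝ) - 2)) * ω1 y -
    ((N : ℝ) / (2 * ((N : ℝ) - 2))) * PU N k L P s κ x μ y ^ (2 / ((N : ℝ) - 2)) *
      PV N k L P s κ x μ y ^ (2 / ((N : ℝ) - 2)) * ω2 y

/-- Second component `N₂` of the higher order term. -/
def Nl2 (N k : ℕ) (L : ℝ) (P : ℕ → Euc N) (s κ : ℝ) (K2 : Euc N → ℝ) (x : Euc N) (μ : ℝ)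
    (ω1 ω2 : Euc N → ℝ) (y : Euc N) : ℝ :=
  K2 y * ((max (PV N k L P s κ x μ y + ω2 y) 0) ^ (tS N - 1) -
      PV N k L P s κ x μ y ^ (tS N - 1) -
      (tS N - 1) * PV N k L P s κ x μ y ^ (tS N - 2) * ω2 y) +
    (1 / 2) * ((PV N k L P s κ x μ y + ω2 y) ^ (2 / ((N : ℝ) - 2)) *
        (PU N k L P s κ x μ y + ω1 y) ^ ((N : ℝ) / ((N : ℝ) - 2)) -
      PV N k L P s κ x μ y ^ (2 / ((N : ℝ) - 2)) *
        PU N k L P s κ x μ y ^ ((N : ℝ) / ((N : ℝ) - 2))) -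
    (1 / ((N : ℝ) - 2)) * PV N k L P s κ x μ y ^ ((4 - (N : ℝ)) / ((N : ℝ) - 2)) *
      PU N k L P s κ x μ y ^ ((N : ℝ) / ((N : ℝ) - 2)) * ω2 y -
    ((N : ℝ) / (2 * ((N : ℝ) - 2))) * PV N k L P s κ x μ y ^ (2 / ((N : ℝ) - 2)) *
      PU N k L P s κ x μ y ^ (2 / ((N : ℝ) - 2)) * ω1 y


theorem lintegral_ball_norm_rpow_lt_top {E : Type*} [NormedAddCommGroup E] [NormedSpace ℝ E]
    [FiniteDimensional ℝ E] [Nontrivial E] [MeasurableSpace E] [BorelSpace E] (ν : Measure E)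
    [ν.IsAddHaarMeasure] {p : ℝ} (hp : p < Module.finrank ℝ E) :
    ∫⁻ u, (Metric.ball (0 : E) 1).indicator (fun u => ENNReal.ofReal (‖u‖ ^ (-p))) u ∂ν < ⊤ := by
  rw [lintegral_indicator Metric.isOpen_ball.measurableSet]
  have hd : 1 ≤ Module.finrank ℝ E := Module.finrank_pos
  have h : IntegrableOn (fun u : E => (fun t : ℝ => t ^ (-p)) ‖u‖) (Metric.ball 0 1) ν := by
    rw [integrableOn_fun_norm_addHaar ν (f := fun t : ℝ => t ^ (-p))]
    have h2 : IntegrableOn (fun t : ℝ => t ^ ((Module.finrank ℝ E : ℝ) - 1 - p)) (Set.Ioo 0 1) := by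
      have := intervalIntegral.intervalIntegrable_rpow' (a := 0) (b := 1)
        (r := (Module.finrank ℝ E : ℝ) - 1 - p) (by linarith)
      rw [intervalIntegrable_iff_integrableOn_Ioo_of_le zero_le_one] at this
      exact this
    refine h2.congr_fun (fun t ht => ?_) measurableSet_Ioo
    simp only [smul_eq_mul]
    rw [← Real.rpow_natCast, ← Real.rpow_add ht.1, Nat.cast_sub hd]
    congr 1
    push_cast
    ring
  have := h.2
  rw [hasFiniteIntegral_iff_enorm] at this
  convert this using 3 with u
  rw [Real.enorm_of_nonneg (by positivity)]

theorem riesz_kernel_le {E : Type*} [NormedAddCommGroup E] {p γ δ : ℝ} (hp : 0 < p) (hγ : 0 < γ)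
    (hδ : 0 < δ) {u v : E} (hv : ‖v‖ = 1 - δ) (hu : u ≠ 0) :
    ENNReal.ofReal (‖u - v‖ ^ (-p)) * ENNReal.ofReal ((δ + ‖u‖) ^ (-(γ + 2))) ≤
      ENNReal.ofReal (2 ^ (γ + 2)) *
          (Metric.ball (0 : E) 1).indicator (fun u => ENNReal.ofReal (‖u‖ ^ (-p))) (u - v) +
        ENNReal.ofReal (2 ^ p) *
          (Metric.ball (0 : E) 1).indicator (fun u => ENNReal.ofReal (‖u‖ ^ (-(γ + 2)))) u +
        ENNReal.ofReal (6 ^ p * 2 ^ (γ + 2)) * ENNReal.ofReal ((1 + ‖u‖) ^ (-(p + 2 + γ))) := by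
  have hu0 : 0 < ‖u‖ := norm_pos_iff.2 hu
  have tri : ‖v‖ ≤ ‖u‖ + ‖u - v‖ := by
    have := norm_sub_le u (u - v); simpa using this
  have tri2 : ‖u‖ ≤ ‖u - v‖ + ‖v‖ := by
    have := norm_add_le (u - v) v; simpa using this
  have key : ∀ {b c q : ℝ}, 0 < b → 0 < c → 0 < q → c ≤ b → b ^ (-q) ≤ c ^ (-q) :=
    fun hb hc hq h => Real.rpow_le_rpow_of_nonpos hc (by linarith) (by linarith)
  have half : ∀ q : ℝ, (1 / 2 : ℝ) ^ (-q) = 2 ^ q := fun q => by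
    rw [Real.rpow_neg (by norm_num), ← Real.inv_rpow (by norm_num)]; norm_num
  rcases lt_or_ge ‖u - v‖ (1 / 2) with h | h
  · refine le_trans ?_ (le_trans le_self_add le_self_add)
    rw [Set.indicator_of_mem (by rw [mem_ball_zero_iff]; linarith), mul_comm]
    gcongr
    rw [← half]
    exact key (by positivity) (by norm_num) (by linarith) (by linarith)
  · rcases lt_or_ge ‖u‖ 1 with h1 | h1
    · refine le_trans ?_ (le_trans le_add_self le_self_add)
      rw [Set.indicator_of_mem (by rwa [mem_ball_zero_iff])]
      refine mul_le_mul' (ENNReal.ofReal_le_ofReal ?_) (ENNReal.ofReal_le_ofReal ?_)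
      · rw [← half]
        exact key (by linarith) (by norm_num) hp (by linarith)
      · exact key (by positivity) hu0 (by linarith) (by linarith)
    · refine le_trans ?_ le_add_self
      rw [← ENNReal.ofReal_mul (by positivity), ← ENNReal.ofReal_mul (by positivity)]
      apply ENNReal.ofReal_le_ofReal
      have e1 : ‖u - v‖ ^ (-p) ≤ 6 ^ p * (1 + ‖u‖) ^ (-p) := by
        have : (6 : ℝ) ^ p = (1 / 6 : ℝ) ^ (-p) := by
          rw [Real.rpow_neg (by norm_num), ← Real.inv_rpow (by norm_num)]; norm_num
        rw [this, ← Real.mul_rpow (by norm_num) (by positivity)]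
        exact key (by linarith) (by positivity) hp (by linarith)
      have e2 : (δ + ‖u‖) ^ (-(γ + 2)) ≤ 2 ^ (γ + 2) * (1 + ‖u‖) ^ (-(γ + 2)) := by
        rw [← half, ← Real.mul_rpow (by norm_num) (by positivity)]
        exact key (by positivity) (by positivity) (by linarith) (by linarith)
      calc _ ≤ (6 ^ p * (1 + ‖u‖) ^ (-p)) * (2 ^ (γ + 2) * (1 + ‖u‖) ^ (-(γ + 2))) := by gcongr
        _ = 6 ^ p * 2 ^ (γ + 2) * ((1 + ‖u‖) ^ (-p) * (1 + ‖u‖) ^ (-(γ + 2))) := by ring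
        _ = _ := by
          rw [← Real.rpow_add (by positivity)]; ring_nf

theorem exists_lintegral_riesz_unit_le (N : ℕ) (hN : 3 ≤ N) {γ : ℝ} (hγ : 0 < γ)
    (hγN : γ < (N : ℝ) - 2) :
    ∃ C : ℝ, 0 < C ∧ ∀ δ : ℝ, 0 < δ → δ ≤ 1 → ∀ v : Euc N, ‖v‖ = 1 - δ →
      ∫⁻ u : Euc N, ENNReal.ofReal (‖u - v‖ ^ (-((N : ℝ) - 2))) *
        ENNReal.ofReal ((δ + ‖u‖) ^ (-(γ + 2))) ≤ ENNReal.ofReal C := by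
  have hN' : (3 : ℝ) ≤ N := by exact_mod_cast hN
  have : Nonempty (Fin N) := ⟨⟨0, by omega⟩⟩
  have hfr : Module.finrank ℝ (Euc N) = N := by simp
  have hA := lintegral_ball_norm_rpow_lt_top (E := Euc N) volume (p := (N : ℝ) - 2)
    (by rw [hfr]; linarith)
  have hB := lintegral_ball_norm_rpow_lt_top (E := Euc N) volume (p := γ + 2)
    (by rw [hfr]; linarith)
  have hD := finite_integral_one_add_norm (E := Euc N) (μ := volume) (r := (N : ℝ) - 2 + 2 + γ)
    (by rw [hfr]; linarith)
  set A := ∫⁻ u : Euc N, (Metric.ball (0 : Euc N) 1).indicator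
    (fun u => ENNReal.ofReal (‖u‖ ^ (-((N : ℝ) - 2)))) u
  set B := ∫⁻ u : Euc N, (Metric.ball (0 : Euc N) 1).indicator
    (fun u => ENNReal.ofReal (‖u‖ ^ (-(γ + 2)))) u
  set D := ∫⁻ u : Euc N, ENNReal.ofReal ((1 + ‖u‖) ^ (-((N : ℝ) - 2 + 2 + γ)))
  set T := ENNReal.ofReal (2 ^ (γ + 2)) * A + ENNReal.ofReal (2 ^ ((N : ℝ) - 2)) * B +
    ENNReal.ofReal (6 ^ ((N : ℝ) - 2) * 2 ^ (γ + 2)) * D with hT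
  have hTtop : T ≠ ⊤ := by
    simp only [hT, ne_eq, ENNReal.add_eq_top, ENNReal.mul_eq_top, ENNReal.ofReal_ne_top, hA.ne,
      hB.ne, hD.ne]
    simp
  refine ⟨T.toReal + 1, by positivity, fun δ hδ hδ1 v hv => ?_⟩
  have hm : ∀ q : ℝ, Measurable ((Metric.ball (0 : Euc N) 1).indicator
      (fun u => ENNReal.ofReal (‖u‖ ^ (-q)))) := fun q =>
    Measurable.indicator (by fun_prop) Metric.isOpen_ball.measurableSet
  calc _ ≤ ∫⁻ u : Euc N, (ENNReal.ofReal (2 ^ (γ + 2)) *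
          (Metric.ball (0 : Euc N) 1).indicator
            (fun u => ENNReal.ofReal (‖u‖ ^ (-((N : ℝ) - 2)))) (u - v) +
        ENNReal.ofReal (2 ^ ((N : ℝ) - 2)) *
          (Metric.ball (0 : Euc N) 1).indicator
            (fun u => ENNReal.ofReal (‖u‖ ^ (-(γ + 2)))) u +
        ENNReal.ofReal (6 ^ ((N : ℝ) - 2) * 2 ^ (γ + 2)) *
          ENNReal.ofReal ((1 + ‖u‖) ^ (-((N : ℝ) - 2 + 2 + γ)))) := by
        apply lintegral_mono_ae
        filter_upwards [compl_mem_ae_iff.2 (measure_singleton (0 : Euc N))] with u hu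
        exact riesz_kernel_le (by linarith) hγ hδ hv hu
    _ = T := by
        have hmv : Measurable fun u : Euc N => (Metric.ball (0 : Euc N) 1).indicator
            (fun u => ENNReal.ofReal (‖u‖ ^ (-((N : ℝ) - 2)))) (u - v) :=
          (hm _).comp (measurable_id.sub_const v)
        rw [lintegral_add_right _ (by fun_prop), lintegral_add_right _ ((hm _).const_mul _),
          lintegral_const_mul _ hmv,
          lintegral_const_mul _ (hm _), lintegral_const_mul _ (by fun_prop),
          lintegral_sub_right_eq_self (fun u => (Metric.ball (0 : Euc N) 1).indicator
            (fun u => ENNReal.ofReal (‖u‖ ^ (-((N : ℝ) - 2)))) u) v]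
    _ ≤ ENNReal.ofReal (T.toReal + 1) := by
        rw [← ENNReal.ofReal_toReal hTtop]
        apply ENNReal.ofReal_le_ofReal
        rw [ENNReal.toReal_ofReal ENNReal.toReal_nonneg]
        linarith

theorem lintegral_eq_comp_affine {N : ℕ} {f : Euc N → ENNReal} (hf : Measurable f) {r : ℝ}
    (hr : 0 < r) (a : Euc N) :
    ∫⁻ z, f z = ENNReal.ofReal (r ^ N) * ∫⁻ u, f (a + r • u) := by
  have h1 := Measure.map_addHaar_smul (volume : Measure (Euc N)) hr.ne'
  have h2 : ∫⁻ u, f (a + r • u) = ENNReal.ofReal (|(r ^ N)⁻¹|) * ∫⁻ z, f (a + z) := by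
    have h3 := lintegral_map (μ := (volume : Measure (Euc N))) (f := fun z => f (a + z))
      (g := fun u : Euc N => r • u) (by fun_prop) (by fun_prop)
    rw [h1, lintegral_smul_measure] at h3
    rw [← h3]
    simp
  rw [h2, lintegral_add_left_eq_self f a, ← mul_assoc, ← ENNReal.ofReal_mul (by positivity),
    abs_of_pos (by positivity), mul_inv_cancel₀ (by positivity), ENNReal.ofReal_one, one_mul]

theorem exists_lintegral_riesz_le (N : ℕ) (hN : 3 ≤ N) {γ : ℝ} (hγ : 0 < γ)
    (hγN : γ < (N : ℝ) - 2) :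
    ∃ C : ℝ, 0 < C ∧ ∀ μ : ℝ, 0 < μ → ∀ a y : Euc N,
      ∫⁻ z : Euc N, ENNReal.ofReal (‖z - y‖ ^ (-((N : ℝ) - 2))) *
        ENNReal.ofReal ((1 + μ * ‖z - a‖) ^ (-(γ + 2))) ≤
      ENNReal.ofReal (C * μ ^ (-2 : ℝ) * (1 + μ * ‖y - a‖) ^ (-γ)) := by
  obtain ⟨C, hC, h⟩ := exists_lintegral_riesz_unit_le N hN hγ hγN
  refine ⟨C, hC, fun μ hμ a y => ?_⟩
  set w := 1 + μ * ‖y - a‖ with hw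
  have hw1 : 1 ≤ w := by
    have : 0 ≤ μ * ‖y - a‖ := by positivity
    linarith
  have hw0 : 0 < w := by linarith
  set r := w / μ with hr
  have hr0 : 0 < r := by positivity
  set v : Euc N := r⁻¹ • (y - a) with hv
  have hvn : ‖v‖ = 1 - 1 / w := by
    rw [hv, norm_smul, Real.norm_of_nonneg (by positivity), hr]
    field_simp
    rw [hw]; ring
  rw [lintegral_eq_comp_affine (by fun_prop) hr0 a]
  have hpt : ∀ u : Euc N, ENNReal.ofReal (‖a + r • u - y‖ ^ (-((N : ℝ) - 2))) *
        ENNReal.ofReal ((1 + μ * ‖a + r • u - a‖) ^ (-(γ + 2))) =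
      ENNReal.ofReal (r ^ (-((N : ℝ) - 2)) * w ^ (-(γ + 2))) *
        (ENNReal.ofReal (‖u - v‖ ^ (-((N : ℝ) - 2))) *
          ENNReal.ofReal ((1 / w + ‖u‖) ^ (-(γ + 2)))) := by
    intro u
    have e1 : a + r • u - y = r • (u - v) := by
      rw [hv, smul_sub, smul_smul, mul_inv_cancel₀ hr0.ne', one_smul]; abel
    have e2 : 1 + μ * ‖a + r • u - a‖ = w * (1 / w + ‖u‖) := by
      rw [add_sub_cancel_left, norm_smul, Real.norm_of_nonneg hr0.le, hr]
      field_simp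
    rw [e1, e2, norm_smul, Real.norm_of_nonneg hr0.le, Real.mul_rpow hr0.le (norm_nonneg _),
      Real.mul_rpow hw0.le (by positivity), ENNReal.ofReal_mul (by positivity),
      ENNReal.ofReal_mul (by positivity), ENNReal.ofReal_mul (by positivity)]
    ring
  simp_rw [hpt]
  rw [lintegral_const_mul _ (by fun_prop), ← mul_assoc, ← ENNReal.ofReal_mul (by positivity)]
  calc _ ≤ ENNReal.ofReal (r ^ N * (r ^ (-((N : ℝ) - 2)) * w ^ (-(γ + 2)))) *
        ENNReal.ofReal C := by
        gcongr
        exact h (1 / w) (by positivity) (by rw [div_le_one hw0]; exact hw1) v hvn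
    _ = _ := by
        rw [← ENNReal.ofReal_mul (by positivity)]
        congr 1
        rw [← Real.rpow_natCast, ← mul_assoc, ← Real.rpow_add hr0,
          show (N : ℝ) + -((N : ℝ) - 2) = 2 by ring, hr, Real.div_rpow hw0.le hμ.le,
          Real.rpow_neg hμ.le, show -(γ + 2) = -γ + -2 by ring, Real.rpow_add hw0,
          Real.rpow_neg hw0.le 2]
        have : w ^ (2 : ℝ) ≠ 0 := by positivity
        field_simp

/-- The point of `Q_k` with integer coordinates `n`. -/
def latticeVec (N : ℕ) {k : ℕ} (n : Fin k → ℤ) : Euc N :=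
  WithLp.toLp 2 fun i => if h : (i : ℕ) < k then (n ⟨i, h⟩ : ℝ) else 0

theorem latticeVec_apply (N : ℕ) {k : ℕ} (n : Fin k → ℤ) (i : Fin N) :
    latticeVec N n i = if h : (i : ℕ) < k then (n ⟨i, h⟩ : ℝ) else 0 := rfl

theorem latticeVec_add (N : ℕ) {k : ℕ} (n m : Fin k → ℤ) :
    latticeVec N (n + m) = latticeVec N n + latticeVec N m := by
  ext i
  by_cases h : (i : ℕ) < k <;> simp [latticeVec_apply, h]

theorem latticeVec_zero (N k : ℕ) : latticeVec N (0 : Fin k → ℤ) = 0 := by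
  ext i
  simp [latticeVec_apply]

theorem latticeVec_injective {N k : ℕ} (hk : k ≤ N) :
    Function.Injective (latticeVec N : (Fin k → ℤ) → Euc N) := by
  intro n m h
  ext i
  have := congrArg (fun v : Euc N => v ⟨i, i.2.trans_le hk⟩) h
  simpa [latticeVec_apply] using this

theorem range_latticeVec (N k : ℕ) (hk : k ≤ N) :
    Set.range (latticeVec N : (Fin k → ℤ) → Euc N) = Qlat N k := by
  ext y
  constructor
  · rintro ⟨n, rfl⟩
    refine ⟨fun i => ?_, fun i hi => ?_⟩
    · by_cases h : (i : ℕ) < k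
      · exact ⟨n ⟨i, h⟩, by simp [latticeVec_apply, h]⟩
      · exact ⟨0, by simp [latticeVec_apply, h]⟩
    · simp [latticeVec_apply, hi.not_gt]
  · rintro ⟨h1, h2⟩
    choose m hm using h1
    refine ⟨fun i => m ⟨i, i.2.trans_le hk⟩, ?_⟩
    ext i
    by_cases h : (i : ℕ) < k
    · simp [latticeVec_apply, h, hm]
    · simp [latticeVec_apply, h, h2 i (not_lt.1 h)]

theorem LatticeEnum.tsum_eq {N k : ℕ} {P : ℕ → Euc N} (hP : LatticeEnum N k P) (hk : k ≤ N)
    (f : Euc N → ENNReal) :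
    ∑' j, f (P j) = ∑' n : Fin k → ℤ, f (latticeVec N n) := by
  rw [← tsum_range f hP.1, ← tsum_range f (latticeVec_injective hk), hP.2.1,
    range_latticeVec N k hk]

theorem norm_intCast_le_norm_latticeVec {N k : ℕ} (hk : k ≤ N) (n : Fin k → ℤ) :
    ‖(fun i => (n i : ℝ))‖ ≤ ‖latticeVec N n‖ := by
  rw [pi_norm_le_iff_of_nonneg (norm_nonneg _)]
  intro i
  have := PiLp.norm_apply_le (latticeVec N n) ⟨i, i.2.trans_le hk⟩
  simpa [latticeVec_apply] using this

theorem exists_tsum_one_add_norm_latticeVec_le {N k : ℕ} (hk : k ≤ N) {κ : ℝ} (hκ : (k : ℝ) < κ) :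
    ∃ Z : ℝ, 0 < Z ∧ ∑' n : Fin k → ℤ, ENNReal.ofReal ((1 + ‖latticeVec N n‖) ^ (-κ)) ≤
      ENNReal.ofReal Z := by
  have hκ0 : 0 < κ := lt_of_le_of_lt (Nat.cast_nonneg _) hκ
  let b := Pi.basisFun ℝ (Fin k)
  let Λ := Submodule.span ℤ (Set.range b)
  have hfin : Module.finrank ℤ Λ = k := by
    rw [ZLattice.rank ℝ Λ]; simp
  have hs := ZLattice.summable_norm_rpow Λ (-κ) (by rw [hfin]; linarith)
  let g : (Fin k → ℤ) → Λ := fun n => ⟨fun i => (n i : ℝ), by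
    rw [b.mem_span_iff_repr_mem ℤ]
    intro i
    exact ⟨n i, by simp [b]⟩⟩
  have hg : Function.Injective g := by
    intro n m h
    ext i
    have := congrFun (congrArg Subtype.val h) i
    simpa [g] using this
  have hs2 : Summable fun n : Fin k → ℤ => (1 + ‖latticeVec N n‖) ^ (-κ) := by
    have h0 : Summable fun n : Fin k → ℤ => ‖g n‖ ^ (-κ) + if n = 0 then 1 else 0 :=
      (hs.comp_injective hg).add (summable_of_hasFiniteSupport
        ((Set.finite_singleton (0 : Fin k → ℤ)).subset (by intro n; simp)))
    refine h0.of_nonneg_of_le (fun n => by positivity) fun n => ?_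
    by_cases hn : n = 0
    · simp only [hn, if_true, latticeVec_zero, norm_zero, add_zero, Real.one_rpow]
      have : 0 ≤ ‖g 0‖ ^ (-κ) := by positivity
      linarith
    · simp only [hn, if_false, add_zero]
      have hpos : 0 < ‖g n‖ := by
        rw [norm_pos_iff]
        intro h
        apply hn
        apply hg
        rw [h]
        ext i
        simp [g]
      refine Real.rpow_le_rpow_of_nonpos hpos ?_ (by linarith)
      have := norm_intCast_le_norm_latticeVec hk n
      change ‖(fun i => (n i : ℝ))‖ ≤ _
      linarith
  refine ⟨(∑' n : Fin k → ℤ, (1 + ‖latticeVec N n‖) ^ (-κ)) + 1, ?_, ?_⟩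
  · have : 0 ≤ ∑' n : Fin k → ℤ, (1 + ‖latticeVec N n‖) ^ (-κ) :=
      tsum_nonneg fun n => by positivity
    linarith
  · rw [← ENNReal.ofReal_tsum_of_nonneg (fun n => by positivity) hs2]
    exact ENNReal.ofReal_le_ofReal (by linarith)

theorem norm_le_norm_add_latticeVec {N k : ℕ} {L : ℝ} (hL : 0 ≤ L) {z : Euc N}
    (hz : z ∈ strip N k L) (n : Fin k → ℤ) : ‖z‖ ≤ ‖z + L • latticeVec N n‖ := by
  rw [EuclideanSpace.norm_eq, EuclideanSpace.norm_eq]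
  apply Real.sqrt_le_sqrt
  refine Finset.sum_le_sum fun i _ => ?_
  simp only [PiLp.add_apply, PiLp.smul_apply, smul_eq_mul, latticeVec_apply, Real.norm_eq_abs]
  by_cases h : (i : ℕ) < k
  · simp only [h, dif_pos]
    have h1 := hz i h
    refine pow_le_pow_left₀ (abs_nonneg _) ?_ 2
    by_cases h0 : n ⟨i, h⟩ = 0
    · simp [h0]
    · have h2 : (1 : ℝ) ≤ |(n ⟨i, h⟩ : ℝ)| := by
        exact_mod_cast Int.one_le_abs h0
      have h3 : L ≤ |L * (n ⟨i, h⟩ : ℝ)| := by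
        rw [abs_mul, abs_of_nonneg hL]; nlinarith
      have h4 := abs_sub_abs_le_abs_add (L * (n ⟨i, h⟩ : ℝ)) (z i)
      rw [add_comm (z i)]
      linarith
  · simp [h]

theorem tsum_indicator_strip_le {N k : ℕ} (hk : k ≤ N) {L : ℝ} (hL : 0 < L) (z : Euc N) :
    ∑' n : Fin k → ℤ, (strip N k L).indicator (1 : Euc N → ENNReal) (z - L • latticeVec N n) ≤
      2 ^ k := by
  let c : Fin k → ℤ := fun i => ⌈z ⟨i, i.2.trans_le hk⟩ / L - 1 / 2⌉
  let S : Finset (Fin k → ℤ) := Fintype.piFinset fun i => {c i, c i + 1}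
  rw [tsum_eq_sum (s := S)]
  · calc _ ≤ ∑ n ∈ S, (1 : ENNReal) :=
        Finset.sum_le_sum fun n _ =>
          Set.indicator_le_self' (f := (1 : Euc N → ENNReal)) (fun _ _ => zero_le) _
      _ ≤ 2 ^ k := by
        rw [Finset.sum_const, nsmul_eq_mul, mul_one, Fintype.card_piFinset]
        simp
  · intro n hn
    apply Set.indicator_of_notMem
    intro hmem
    apply hn
    rw [Fintype.mem_piFinset]
    intro i
    have h := hmem ⟨i, i.2.trans_le hk⟩ i.2
    simp only [PiLp.sub_apply, PiLp.smul_apply, smul_eq_mul, latticeVec_apply, i.2, dif_pos] at h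
    rw [abs_le] at h
    set t := z ⟨i, i.2.trans_le hk⟩
    have ht : t / L * L = t := div_mul_cancel₀ _ hL.ne'
    have h1 : t / L - 1 / 2 ≤ n i := by
      by_contra! hcon
      nlinarith [h.2]
    have h2 : (n i : ℝ) ≤ t / L - 1 / 2 + 1 := by
      by_contra! hcon
      nlinarith [h.1]
    have h3 : c i ≤ n i := Int.ceil_le.2 h1
    have h4 : n i < c i + 2 := by
      have := Int.le_ceil (t / L - 1 / 2)
      have h5 : (n i : ℝ) < (c i : ℝ) + 2 := by
        change (n i : ℝ) < ((⌈t / L - 1 / 2⌉ : ℤ) : ℝ) + 2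
        linarith
      exact_mod_cast h5
    simp only [Finset.mem_insert, Finset.mem_singleton]
    omega

theorem measurableSet_strip (N k : ℕ) (L : ℝ) : MeasurableSet (strip N k L) := by
  have : strip N k L = ⋂ i : Fin N, ⋂ _ : (i : ℕ) < k, {y : Euc N | |y i| ≤ L / 2} := by
    ext; simp [strip]
  rw [this]
  refine MeasurableSet.iInter fun i => MeasurableSet.iInter fun _ => ?_
  exact measurableSet_le (by fun_prop) measurable_const

theorem setLIntegral_strip_tsum_mul_tsum_le {N k : ℕ} (hk : k ≤ N) {L : ℝ} (hL : 0 < L)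
    {f g : Euc N → ENNReal} (hf : Measurable f) (hg : Measurable g) :
    ∫⁻ z in strip N k L, (∑' n : Fin k → ℤ, f (z + L • latticeVec N n)) *
        ∑' m : Fin k → ℤ, g (z + L • latticeVec N m) ≤
      2 ^ k * ∑' l : Fin k → ℤ, ∫⁻ z, f z * g (z + L • latticeVec N l) := by
  set χ := (strip N k L).indicator (1 : Euc N → ENNReal) with hχ
  have hχm : Measurable χ := measurable_one.indicator (measurableSet_strip N k L)
  have hreindex : ∀ z, ∀ n : Fin k → ℤ, ∑' m : Fin k → ℤ, g (z + L • latticeVec N m) =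
      ∑' l : Fin k → ℤ, g (z + L • latticeVec N n + L • latticeVec N l) := by
    intro z n
    rw [← (Equiv.addLeft n).tsum_eq]
    refine tsum_congr fun l => ?_
    simp [latticeVec_add, add_assoc]
  calc _ = ∫⁻ z, ∑' l : Fin k → ℤ, ∑' n : Fin k → ℤ, χ z * (f (z + L • latticeVec N n) *
          g (z + L • latticeVec N n + L • latticeVec N l)) := by
        rw [← lintegral_indicator (measurableSet_strip N k L)]
        refine lintegral_congr fun z => ?_
        rw [ENNReal.tsum_comm]
        by_cases hz : z ∈ strip N k L
        · simp only [hχ, Set.indicator_of_mem hz, Pi.one_apply, one_mul, ENNReal.tsum_mul_left]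
          rw [← ENNReal.tsum_mul_right]
          exact tsum_congr fun n => by rw [← hreindex z n]
        · simp [hχ, Set.indicator_of_notMem hz]
    _ = ∑' l : Fin k → ℤ, ∑' n : Fin k → ℤ, ∫⁻ z, χ z * (f (z + L • latticeVec N n) *
          g (z + L • latticeVec N n + L • latticeVec N l)) := by
        rw [lintegral_tsum fun l => (Measurable.tsum fun n => by fun_prop).aemeasurable]
        exact tsum_congr fun l => lintegral_tsum fun n => by fun_prop
    _ = ∑' l : Fin k → ℤ, ∑' n : Fin k → ℤ, ∫⁻ z, χ (z - L • latticeVec N n) * (f z *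
          g (z + L • latticeVec N l)) := by
        refine tsum_congr fun l => tsum_congr fun n => ?_
        rw [← lintegral_add_right_eq_self (fun z => χ (z - L • latticeVec N n) * (f z *
          g (z + L • latticeVec N l))) (L • latticeVec N n)]
        simp
    _ = ∑' l : Fin k → ℤ, ∫⁻ z, (∑' n : Fin k → ℤ, χ (z - L • latticeVec N n)) * (f z *
          g (z + L • latticeVec N l)) := by
        refine tsum_congr fun l => ?_
        rw [← lintegral_tsum fun n => by fun_prop]
        simp_rw [ENNReal.tsum_mul_right]
    _ ≤ ∑' l : Fin k → ℤ, ∫⁻ z, 2 ^ k * (f z * g (z + L • latticeVec N l)) := by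
        gcongr with l z
        exact tsum_indicator_strip_le hk hL z
    _ = _ := by
        rw [← ENNReal.tsum_mul_left]
        exact tsum_congr fun l => lintegral_const_mul _ (by fun_prop)

theorem norm_latticeVec_tdiv_le (N : ℕ) {k : ℕ} (n : Fin k → ℤ) :
    ‖latticeVec N (fun i => (n i).tdiv 8)‖ ≤ ‖latticeVec N n‖ / 8 := by
  have h8 : ‖latticeVec N n‖ / 8 = ‖(1 / 8 : ℝ) • latticeVec N n‖ := by
    rw [norm_smul]; norm_num; ring
  rw [h8, EuclideanSpace.norm_eq, EuclideanSpace.norm_eq]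
  apply Real.sqrt_le_sqrt
  refine Finset.sum_le_sum fun i _ => ?_
  refine pow_le_pow_left₀ (norm_nonneg _) ?_ 2
  simp only [PiLp.smul_apply, smul_eq_mul, latticeVec_apply, Real.norm_eq_abs]
  by_cases h : (i : ℕ) < k
  · simp only [h, dif_pos]
    rw [abs_mul, abs_of_pos (by norm_num : (0 : ℝ) < 1 / 8), ← Int.cast_abs, ← Int.cast_abs,
      Int.abs_eq_natAbs, Int.abs_eq_natAbs, Int.natAbs_tdiv, Int.cast_natCast, Int.cast_natCast]
    have : (((n ⟨i, h⟩).natAbs / 8 : ℕ) : ℝ) ≤ (n ⟨i, h⟩).natAbs / (8 : ℕ) := Nat.cast_div_le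
    change (((n ⟨i, h⟩).natAbs / 8 : ℕ) : ℝ) ≤ _
    rw [Nat.cast_ofNat] at this
    linarith
  · simp [h]

theorem tsum_comp_tdiv_le {k : ℕ} (h : (Fin k → ℤ) → ENNReal) :
    ∑' n : Fin k → ℤ, h (fun i => (n i).tdiv 8) ≤ 16 ^ k * ∑' n, h n := by
  let φ : (Fin k → ℤ) → (Fin k → ZMod 16) × (Fin k → ℤ) :=
    fun n => (fun i => (n i : ZMod 16), fun i => (n i).tdiv 8)
  have hφ : Function.Injective φ := by
    intro n m hnm
    ext i
    have h1 := congrFun (congrArg Prod.fst hnm) i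
    have h2 := congrFun (congrArg Prod.snd hnm) i
    simp only [φ] at h1 h2
    rw [ZMod.intCast_eq_intCast_iff_dvd_sub] at h1
    have a1 := Int.mul_tdiv_add_tmod (n i) 8
    have a2 := Int.mul_tdiv_add_tmod (m i) 8
    have b1 := Int.tmod_lt_of_pos (n i) (b := 8) (by norm_num)
    have b2 := Int.tmod_lt_of_pos (m i) (b := 8) (by norm_num)
    have c1 := Int.lt_tmod_of_pos (n i) (b := 8) (by norm_num)
    have c2 := Int.lt_tmod_of_pos (m i) (b := 8) (by norm_num)
    rw [h2] at a1
    push_cast at h1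
    obtain ⟨c, hc⟩ := h1
    omega
  calc _ = ∑' n : Fin k → ℤ, (fun p : (Fin k → ZMod 16) × (Fin k → ℤ) => h p.2) (φ n) := rfl
    _ ≤ ∑' p : (Fin k → ZMod 16) × (Fin k → ℤ), h p.2 :=
      ENNReal.tsum_comp_le_tsum_of_injective hφ _
    _ = _ := by
      rw [ENNReal.tsum_prod (f := fun _ b => h b), tsum_fintype]
      simp

theorem rpow_neg_mul_tsum_le {N k : ℕ} (hk : 1 ≤ k) {α q : ℝ} (hα : 2 * (k : ℝ) ≤ α)
    (hq : 0 ≤ q) {μ L : ℝ} (hμ : 0 < μ) (hL : 0 < L) (z : Euc N)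
    (hfin : ∑' n : Fin k → ℤ, ENNReal.ofReal ((1 + μ * ‖z + L • latticeVec N n‖) ^ (-α)) ≠ ⊤) :
    ENNReal.ofReal ((1 + μ * ‖z‖) ^ (-q)) *
        ∑' n : Fin k → ℤ, ENNReal.ofReal ((1 + μ * ‖z + L • latticeVec N n‖) ^ (-α)) ≤
      ENNReal.ofReal (2 * 29 ^ q) *
        ∑' n : Fin k → ℤ, ENNReal.ofReal ((1 + μ * ‖z + L • latticeVec N n‖) ^ (-(α + q))) := by
  set D := 1 + μ * ‖z‖ with hD
  have hk1 : (1 : ℝ) ≤ k := by exact_mod_cast hk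
  have hD1 : 1 ≤ D := by
    have : 0 ≤ μ * ‖z‖ := by positivity
    linarith
  have hD0 : 0 < D := by linarith
  let w : (Fin k → ℤ) → ℝ := fun n => 1 + μ * ‖z + L • latticeVec N n‖
  have hw0 : ∀ n, 0 < w n := fun n => by positivity
  have hpt : ∀ n : Fin k → ℤ, ENNReal.ofReal (w n ^ (-α)) ≤
      ENNReal.ofReal ((29 * D) ^ q) * ENNReal.ofReal (w n ^ (-(α + q))) +
        ENNReal.ofReal (6 ^ (-α)) * ENNReal.ofReal (w (fun i => (n i).tdiv 8) ^ (-α)) := by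
    intro n
    rcases le_or_gt (w n) (29 * D) with h | h
    · refine le_trans ?_ le_self_add
      rw [← ENNReal.ofReal_mul (by positivity)]
      apply ENNReal.ofReal_le_ofReal
      calc w n ^ (-α) = w n ^ q * w n ^ (-(α + q)) := by
            rw [← Real.rpow_add (hw0 n)]; ring_nf
        _ ≤ _ := by
            have := (hw0 n).le
            gcongr
    · refine le_trans ?_ le_add_self
      rw [← ENNReal.ofReal_mul (by positivity)]
      apply ENNReal.ofReal_le_ofReal
      rw [← Real.mul_rpow (by norm_num) (hw0 _).le]
      refine Real.rpow_le_rpow_of_nonpos (by have := hw0 (fun i => (n i).tdiv 8); positivity) ?_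
        (by linarith)
      have n1 : ‖z + L • latticeVec N n‖ ≤ ‖z‖ + L * ‖latticeVec N n‖ := by
        refine (norm_add_le _ _).trans ?_
        rw [norm_smul, Real.norm_of_nonneg hL.le]
      have n2 : L * ‖latticeVec N n‖ ≤ ‖z + L • latticeVec N n‖ + ‖z‖ := by
        have := norm_sub_le (z + L • latticeVec N n) z
        rwa [add_sub_cancel_left, norm_smul, Real.norm_of_nonneg hL.le] at this
      have n3 : ‖z + L • latticeVec N (fun i => (n i).tdiv 8)‖ ≤
          ‖z‖ + L * (‖latticeVec N n‖ / 8) := by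
        refine (norm_add_le _ _).trans ?_
        rw [norm_smul, Real.norm_of_nonneg hL.le]
        gcongr
        exact norm_latticeVec_tdiv_le N n
      have m1 := mul_le_mul_of_nonneg_left n1 hμ.le
      have m2 := mul_le_mul_of_nonneg_left n2 hμ.le
      have m3 := mul_le_mul_of_nonneg_left n3 hμ.le
      simp only [w] at h ⊢
      linarith
  set S := ∑' n : Fin k → ℤ, ENNReal.ofReal (w n ^ (-α)) with hS
  set S' := ∑' n : Fin k → ℤ, ENNReal.ofReal (w n ^ (-(α + q))) with hS'
  have hsmall : ENNReal.ofReal (6 ^ (-α)) * 16 ^ k ≤ 2⁻¹ := by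
    have e1 : (16 : ENNReal) ^ k = ENNReal.ofReal (16 ^ k) := by
      rw [ENNReal.ofReal_pow (by norm_num)]; norm_num
    have e2 : (2 : ENNReal)⁻¹ = ENNReal.ofReal (1 / 2) := by
      rw [one_div, ENNReal.ofReal_inv_of_pos (by norm_num)]; norm_num
    rw [e1, e2, ← ENNReal.ofReal_mul (by positivity)]
    apply ENNReal.ofReal_le_ofReal
    have e3 : (6 : ℝ) ^ (-α) ≤ (1 / 36) ^ k := by
      calc (6 : ℝ) ^ (-α) ≤ 6 ^ (-(2 * (k : ℝ))) :=
            Real.rpow_le_rpow_of_exponent_le (by norm_num) (by linarith)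
        _ = (1 / 36) ^ k := by
          rw [Real.rpow_neg (by norm_num), Real.rpow_mul (by norm_num), Real.rpow_natCast]
          rw [Real.rpow_ofNat, one_div, inv_pow]
          norm_num
    calc (6 : ℝ) ^ (-α) * 16 ^ k ≤ (1 / 36) ^ k * 16 ^ k := by gcongr
      _ = (4 / 9) ^ k := by rw [← mul_pow]; norm_num
      _ ≤ (4 / 9) ^ 1 := pow_le_pow_of_le_one (by norm_num) (by norm_num) hk
      _ ≤ 1 / 2 := by norm_num
  have hsum : S ≤ ENNReal.ofReal ((29 * D) ^ q) * S' + 2⁻¹ * S := by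
    calc S ≤ ENNReal.ofReal ((29 * D) ^ q) * S' + ENNReal.ofReal (6 ^ (-α)) *
          ∑' n : Fin k → ℤ, ENNReal.ofReal (w (fun i => (n i).tdiv 8) ^ (-α)) := by
          refine (ENNReal.tsum_le_tsum hpt).trans_eq ?_
          rw [ENNReal.tsum_add, ENNReal.tsum_mul_left, ENNReal.tsum_mul_left]
      _ ≤ ENNReal.ofReal ((29 * D) ^ q) * S' + ENNReal.ofReal (6 ^ (-α)) * (16 ^ k * S) := by
          gcongr
          exact tsum_comp_tdiv_le fun n => ENNReal.ofReal (w n ^ (-α))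
      _ ≤ _ := by
          rw [← mul_assoc (ENNReal.ofReal (6 ^ (-α)))]
          gcongr
  have hSle : S ≤ 2 * (ENNReal.ofReal ((29 * D) ^ q) * S') := by
    have hhalf : 2⁻¹ * S + 2⁻¹ * S = S := by
      rw [← add_mul, ENNReal.inv_two_add_inv_two, one_mul]
    have h2 : 2⁻¹ * S ≤ ENNReal.ofReal ((29 * D) ^ q) * S' := by
      have hne : 2⁻¹ * S ≠ ⊤ := ENNReal.mul_ne_top (by simp) hfin
      rw [← ENNReal.add_le_add_iff_right hne, hhalf]
      exact hsum
    calc S = 2⁻¹ * S + 2⁻¹ * S := hhalf.symm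
      _ ≤ _ := by rw [two_mul]; gcongr
  calc ENNReal.ofReal (D ^ (-q)) * S
      ≤ ENNReal.ofReal (D ^ (-q)) * (2 * (ENNReal.ofReal ((29 * D) ^ q) * S')) := by gcongr
    _ = _ := by
      have : (2 : ENNReal) = ENNReal.ofReal 2 := by norm_num
      rw [this, ← mul_assoc, ← mul_assoc, ← ENNReal.ofReal_mul (by positivity),
        ← ENNReal.ofReal_mul (by positivity)]
      congr 2
      rw [Real.mul_rpow (by norm_num) hD0.le, Real.rpow_neg hD0.le]
      have : D ^ q ≠ 0 := by positivity
      field_simp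

theorem mul_norm_latticeVec_le {N k : ℕ} {L : ℝ} (hL : 0 ≤ L) {z : Euc N}
    (hz : z ∈ strip N k L) (n : Fin k → ℤ) :
    L * ‖latticeVec N n‖ ≤ 2 * ‖z + L • latticeVec N n‖ := by
  have h1 := norm_le_norm_add_latticeVec hL hz n
  have h2 := norm_sub_le (z + L • latticeVec N n) z
  rw [add_sub_cancel_left, norm_smul, Real.norm_of_nonneg hL] at h2
  linarith

theorem half_one_add_norm_latticeVec_le {N k : ℕ} {μ L : ℝ} (hμ : 1 ≤ μ) (hL : 1 ≤ L) {z : Euc N}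
    (hz : z ∈ strip N k L) (n : Fin k → ℤ) :
    1 / 2 * (1 + ‖latticeVec N n‖) ≤ 1 + μ * ‖z + L • latticeVec N n‖ := by
  have h1 := mul_norm_latticeVec_le (by linarith) hz n
  have h2 : ‖latticeVec N n‖ ≤ L * ‖latticeVec N n‖ := le_mul_of_one_le_left (norm_nonneg _) hL
  have h3 := le_mul_of_one_le_left (norm_nonneg (z + L • latticeVec N n)) hμ
  linarith

theorem exists_tsum_rpow_neg_le {N k : ℕ} (hk : k ≤ N) {κ : ℝ} (hκ : (k : ℝ) < κ) :
    ∃ Z : ℝ, 0 < Z ∧ ∀ μ L : ℝ, 1 ≤ μ → 1 ≤ L → ∀ z ∈ strip N k L,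
      ∑' n : Fin k → ℤ, ENNReal.ofReal ((1 + μ * ‖z + L • latticeVec N n‖) ^ (-κ)) ≤
        ENNReal.ofReal Z := by
  have hκ0 : 0 < κ := lt_of_le_of_lt (Nat.cast_nonneg _) hκ
  obtain ⟨Z, hZ, h⟩ := exists_tsum_one_add_norm_latticeVec_le hk hκ
  refine ⟨(1 / 2) ^ (-κ) * Z, by positivity, fun μ L hμ hL z hz => ?_⟩
  calc _ ≤ ∑' n : Fin k → ℤ, ENNReal.ofReal ((1 / 2) ^ (-κ)) *
        ENNReal.ofReal ((1 + ‖latticeVec N n‖) ^ (-κ)) := by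
        refine ENNReal.tsum_le_tsum fun n => ?_
        rw [← ENNReal.ofReal_mul (by positivity)]
        apply ENNReal.ofReal_le_ofReal
        rw [← Real.mul_rpow (by norm_num) (by positivity)]
        exact Real.rpow_le_rpow_of_nonpos (by positivity)
          (half_one_add_norm_latticeVec_le hμ hL hz n) (by linarith)
    _ ≤ _ := by
        rw [ENNReal.tsum_mul_left, ENNReal.ofReal_mul (by positivity)]
        gcongr

/-- The profile `min {1, (w/μ)^(τ-1)}` of the weight `σ`, as a function of `w = 1 + μ|y - x|`. -/
def sigmaProfile (μ τ w : ℝ) : ℝ := min 1 ((w / μ) ^ (τ - 1))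

theorem sigmaProfile_nonneg {μ τ w : ℝ} (hμ : 0 ≤ μ) (hw : 0 ≤ w) : 0 ≤ sigmaProfile μ τ w :=
  le_min zero_le_one (by positivity)

theorem sigmaProfile_mono {μ τ w w' : ℝ} (hμ : 0 ≤ μ) (hτ : 1 ≤ τ) (hw : 0 ≤ w) (h : w ≤ w') :
    sigmaProfile μ τ w ≤ sigmaProfile μ τ w' := by
  have : 0 ≤ τ - 1 := by linarith
  unfold sigmaProfile
  gcongr

theorem sigmaProfile_two_mul_le {μ τ w : ℝ} (hμ : 0 ≤ μ) (hτ : 1 ≤ τ) (hw : 0 ≤ w) :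
    sigmaProfile μ τ (2 * w) ≤ 2 ^ (τ - 1) * sigmaProfile μ τ w := by
  have h1 : (1 : ℝ) ≤ 2 ^ (τ - 1) := Real.one_le_rpow (by norm_num) (by linarith)
  unfold sigmaProfile
  rw [mul_min_of_nonneg _ _ (by positivity), mul_div_assoc,
    Real.mul_rpow (by norm_num) (by positivity), mul_one]
  exact min_le_min_right _ h1

@[fun_prop]
theorem measurable_sigmaProfile (μ τ : ℝ) : Measurable (sigmaProfile μ τ) := by
  unfold sigmaProfile
  fun_prop

theorem div_rpow_mul_rpow_neg {μ w : ℝ} (hμ : 0 < μ) (hw : 0 < w) (τ γ : ℝ) :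
    (w / μ) ^ (τ - 1) * w ^ (-γ) = μ ^ (1 - τ) * w ^ (-(γ - τ + 1)) := by
  rw [Real.div_rpow hw.le hμ.le, show -(γ - τ + 1) = (τ - 1) + -γ by ring, Real.rpow_add hw,
    show 1 - τ = -(τ - 1) by ring, Real.rpow_neg hμ.le]
  field_simp

theorem exists_lintegral_riesz_sigma_le (N : ℕ) (hN : 3 ≤ N) {γ τ : ℝ} (hτ : 1 ≤ τ)
    (hγτ : 0 < γ - τ + 1) (hγN : γ < (N : ℝ) - 2) :
    ∃ C : ℝ, 0 < C ∧ ∀ μ : ℝ, 0 < μ → ∀ a y : Euc N,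
      ∫⁻ z : Euc N, ENNReal.ofReal (‖z - y‖ ^ (-((N : ℝ) - 2))) *
        ENNReal.ofReal (sigmaProfile μ τ (1 + μ * ‖z + a‖) * (1 + μ * ‖z + a‖) ^ (-(γ + 2))) ≤
      ENNReal.ofReal (C * μ ^ (-2 : ℝ)) * ENNReal.ofReal
        (sigmaProfile μ τ (1 + μ * ‖y + a‖) * (1 + μ * ‖y + a‖) ^ (-γ)) := by
  obtain ⟨C₁, hC₁, h₁⟩ := exists_lintegral_riesz_le N hN (γ := γ) (by linarith) hγN
  obtain ⟨C₂, hC₂, h₂⟩ := exists_lintegral_riesz_le N hN (γ := γ - τ + 1) hγτ (by linarith)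
  refine ⟨C₁ + C₂, by positivity, fun μ hμ a y => ?_⟩
  have h₁' := h₁ μ hμ (-a) y
  have h₂' := h₂ μ hμ (-a) y
  simp only [sub_neg_eq_add] at h₁' h₂'
  set w := 1 + μ * ‖y + a‖ with hw
  have hw0 : 0 < w := by positivity
  rw [← ENNReal.ofReal_mul (by positivity)]
  rcases min_choice 1 ((w / μ) ^ (τ - 1)) with h | h
  · have hs : sigmaProfile μ τ w = 1 := h
    rw [hs, one_mul]
    calc _ ≤ ∫⁻ z : Euc N, ENNReal.ofReal (‖z - y‖ ^ (-((N : ℝ) - 2))) *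
          ENNReal.ofReal ((1 + μ * ‖z + a‖) ^ (-(γ + 2))) := by
          gcongr with z
          exact mul_le_of_le_one_left (by positivity) (min_le_left _ _)
      _ ≤ _ := h₁'
      _ ≤ _ := by
          apply ENNReal.ofReal_le_ofReal
          gcongr
          linarith
  · have hs : sigmaProfile μ τ w = (w / μ) ^ (τ - 1) := h
    rw [hs, div_rpow_mul_rpow_neg hμ hw0]
    calc _ ≤ ∫⁻ z : Euc N, ENNReal.ofReal (μ ^ (1 - τ)) *
          (ENNReal.ofReal (‖z - y‖ ^ (-((N : ℝ) - 2))) *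
          ENNReal.ofReal ((1 + μ * ‖z + a‖) ^ (-(γ - τ + 1 + 2)))) := by
          refine lintegral_mono fun z => ?_
          rw [mul_left_comm]
          refine mul_le_mul_right ?_ _
          rw [← ENNReal.ofReal_mul (by positivity)]
          apply ENNReal.ofReal_le_ofReal
          rw [show γ - τ + 1 + 2 = (γ + 2) - τ + 1 by ring,
            ← div_rpow_mul_rpow_neg hμ (by positivity)]
          gcongr
          exact min_le_right _ _
      _ ≤ ENNReal.ofReal (μ ^ (1 - τ)) *
          ENNReal.ofReal (C₂ * μ ^ (-2 : ℝ) * w ^ (-(γ - τ + 1))) := by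
          rw [lintegral_const_mul _ (by fun_prop)]
          gcongr
      _ ≤ _ := by
          rw [← ENNReal.ofReal_mul (by positivity)]
          apply ENNReal.ofReal_le_ofReal
          calc _ = C₂ * μ ^ (-2 : ℝ) * (μ ^ (1 - τ) * w ^ (-(γ - τ + 1))) := by ring
            _ ≤ _ := by
              gcongr
              linarith

theorem exists_tsum_sigma_le {N k : ℕ} (hk : k ≤ N) {γ τ : ℝ} (hτ : 1 ≤ τ)
    (hγτ : (k : ℝ) < γ - τ + 1) :
    ∃ C : ℝ, 0 < C ∧ ∀ μ L : ℝ, 1 ≤ μ → 1 ≤ L → ∀ y ∈ strip N k L,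
      ∑' l : Fin k → ℤ, ENNReal.ofReal (sigmaProfile μ τ (1 + μ * ‖y + L • latticeVec N l‖) *
        (1 + μ * ‖y + L • latticeVec N l‖) ^ (-γ)) ≤
      ENNReal.ofReal (C * sigmaProfile μ τ (1 + μ * ‖y‖)) *
        ∑' l : Fin k → ℤ, ENNReal.ofReal ((1 + μ * ‖y + L • latticeVec N l‖) ^ (-γ)) := by
  obtain ⟨Z, hZ, hsum⟩ := exists_tsum_one_add_norm_latticeVec_le hk hγτ
  set γ' := γ - τ + 1 with hγ'
  have hγ0 : 0 < γ' := lt_of_le_of_lt (Nat.cast_nonneg _) hγτ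
  refine ⟨1 + (1 / 3) ^ (-γ') * Z, by positivity, fun μ L hμ hL y hy => ?_⟩
  have hμ0 : 0 < μ := by linarith
  set w₀ := 1 + μ * ‖y‖ with hw₀
  have hw₀0 : 0 < w₀ := by positivity
  rcases le_or_gt μ w₀ with h | h
  · have hs : sigmaProfile μ τ w₀ = 1 :=
      min_eq_left (Real.one_le_rpow ((one_le_div hμ0).2 h) (by linarith))
    rw [hs, ← ENNReal.tsum_mul_left]
    refine ENNReal.tsum_le_tsum fun l => ?_
    rw [← ENNReal.ofReal_mul (by positivity)]
    apply ENNReal.ofReal_le_ofReal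
    gcongr
    calc _ ≤ (1 : ℝ) := min_le_left _ _
      _ ≤ _ := by
        have : 0 ≤ (1 / 3 : ℝ) ^ (-γ') * Z := by positivity
        linarith
  · have hs : sigmaProfile μ τ w₀ = (w₀ / μ) ^ (τ - 1) :=
      min_eq_right (Real.rpow_le_one (by positivity) ((div_le_one hμ0).2 h.le) (by linarith))
    rw [hs]
    calc _ ≤ ∑' l : Fin k → ℤ, ENNReal.ofReal (μ ^ (1 - τ) * w₀ ^ (-γ') * (1 / 3) ^ (-γ')) *
          ENNReal.ofReal ((1 + ‖latticeVec N l‖) ^ (-γ')) := by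
          refine ENNReal.tsum_le_tsum fun l => ?_
          rw [← ENNReal.ofReal_mul (by positivity)]
          apply ENNReal.ofReal_le_ofReal
          set w := 1 + μ * ‖y + L • latticeVec N l‖ with hw
          have hw0 : 0 < w := by positivity
          have hle : w₀ * (1 / 3 * (1 + ‖latticeVec N l‖)) ≤ w := by
            have a1 := mul_le_mul_of_nonneg_left
              (norm_le_norm_add_latticeVec (by linarith) hy l) hμ0.le
            have a2 := mul_le_mul_of_nonneg_left
              (mul_norm_latticeVec_le (by linarith) hy l) hμ0.le
            have a3 : w₀ * ‖latticeVec N l‖ ≤ μ * (L * ‖latticeVec N l‖) := by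
              gcongr
              exact le_mul_of_one_le_left (norm_nonneg _) hL
            linarith
          calc _ ≤ (w / μ) ^ (τ - 1) * w ^ (-γ) := by
                gcongr
                exact min_le_right _ _
            _ = μ ^ (1 - τ) * w ^ (-γ') := div_rpow_mul_rpow_neg hμ0 hw0 _ _
            _ ≤ μ ^ (1 - τ) * (w₀ * (1 / 3 * (1 + ‖latticeVec N l‖))) ^ (-γ') := by
                refine mul_le_mul_of_nonneg_left ?_ (by positivity)
                exact Real.rpow_le_rpow_of_nonpos (by positivity) hle (by linarith)
            _ = _ := by
                rw [Real.mul_rpow hw₀0.le (by positivity),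
                  Real.mul_rpow (by norm_num) (by positivity)]
                ring
      _ ≤ ENNReal.ofReal (μ ^ (1 - τ) * w₀ ^ (-γ') * (1 / 3) ^ (-γ')) * ENNReal.ofReal Z := by
          rw [ENNReal.tsum_mul_left]
          gcongr
      _ ≤ ENNReal.ofReal ((1 + (1 / 3) ^ (-γ') * Z) * (w₀ / μ) ^ (τ - 1)) *
          ENNReal.ofReal (w₀ ^ (-γ)) := by
          rw [← ENNReal.ofReal_mul (by positivity), ← ENNReal.ofReal_mul (by positivity)]
          apply ENNReal.ofReal_le_ofReal
          rw [mul_assoc (1 + _), div_rpow_mul_rpow_neg hμ0 hw₀0, ← hγ']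
          have : 0 ≤ μ ^ (1 - τ) * w₀ ^ (-γ') := by positivity
          linarith
      _ ≤ _ := by
          gcongr
          refine le_trans ?_ (ENNReal.le_tsum 0)
          simp [latticeVec_zero, hw₀]

theorem exists_setLIntegral_strip_le {N k : ℕ} (hN : 3 ≤ N) (hk : 1 ≤ k) (hkN : k ≤ N)
    {α θ τ : ℝ} (hα : 2 * (k : ℝ) ≤ α) (hθ : 0 ≤ θ) (hτ : 1 ≤ τ)
    (hγτ : (k : ℝ) < α + θ - τ + 1) (hγN : α + θ < (N : ℝ) - 2) :
    ∃ C : ℝ, 0 < C ∧ ∀ μ L : ℝ, 1 ≤ μ → 1 ≤ L → ∀ y ∈ strip N k L,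
      ∫⁻ z in strip N k L,
        (∑' n : Fin k → ℤ, ENNReal.ofReal (‖z + L • latticeVec N n - y‖ ^ (-((N : ℝ) - 2)))) *
        (ENNReal.ofReal (sigmaProfile μ τ (1 + μ * ‖z‖)) *
          (ENNReal.ofReal ((1 + μ * ‖z‖) ^ (-(2 + θ))) *
            ∑' n : Fin k → ℤ, ENNReal.ofReal ((1 + μ * ‖z + L • latticeVec N n‖) ^ (-α)))) ≤
      ENNReal.ofReal (C * μ ^ (-2 : ℝ) * sigmaProfile μ τ (1 + μ * ‖y‖)) *
        ∑' n : Fin k → ℤ, ENNReal.ofReal ((1 + μ * ‖y + L • latticeVec N n‖) ^ (-(α + θ))) := by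
  have hk1 : (1 : ℝ) ≤ k := by exact_mod_cast hk
  obtain ⟨Z, hZ, hsum⟩ := exists_tsum_rpow_neg_le (N := N) hkN (κ := α) (by linarith)
  obtain ⟨C₁, hC₁, h₁⟩ := exists_lintegral_riesz_sigma_le N hN hτ (by linarith) hγN
  obtain ⟨C₂, hC₂, h₂⟩ := exists_tsum_sigma_le hkN hτ hγτ
  refine ⟨2 * 29 ^ (2 + θ) * 2 ^ k * C₁ * C₂, by positivity, fun μ L hμ hL y hy => ?_⟩
  have hμ0 : 0 < μ := by linarith
  have hL0 : 0 < L := by linarith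
  let f : Euc N → ENNReal := fun z => ENNReal.ofReal (‖z - y‖ ^ (-((N : ℝ) - 2)))
  let g : Euc N → ENNReal := fun z =>
    ENNReal.ofReal (sigmaProfile μ τ (1 + μ * ‖z‖) * (1 + μ * ‖z‖) ^ (-(α + θ + 2)))
  have hf : Measurable f := by fun_prop
  have hg : Measurable g := by fun_prop
  have hsource : ∀ z ∈ strip N k L, ENNReal.ofReal (sigmaProfile μ τ (1 + μ * ‖z‖)) *
      (ENNReal.ofReal ((1 + μ * ‖z‖) ^ (-(2 + θ))) *
        ∑' n : Fin k → ℤ, ENNReal.ofReal ((1 + μ * ‖z + L • latticeVec N n‖) ^ (-α))) ≤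
      ENNReal.ofReal (2 * 29 ^ (2 + θ)) * ∑' n : Fin k → ℤ, g (z + L • latticeVec N n) := by
    intro z hz
    calc _ ≤ ENNReal.ofReal (sigmaProfile μ τ (1 + μ * ‖z‖)) *
        (ENNReal.ofReal (2 * 29 ^ (2 + θ)) * ∑' n : Fin k → ℤ,
          ENNReal.ofReal ((1 + μ * ‖z + L • latticeVec N n‖) ^ (-(α + (2 + θ))))) := by
          refine mul_le_mul_right ?_ _
          exact rpow_neg_mul_tsum_le hk hα (by linarith) hμ0 hL0 z
            (ne_top_of_le_ne_top ENNReal.ofReal_ne_top (hsum μ L hμ hL z hz))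
      _ ≤ _ := by
          rw [mul_left_comm, ← ENNReal.tsum_mul_left]
          gcongr with n
          rw [← ENNReal.ofReal_mul (sigmaProfile_nonneg hμ0.le (by positivity)),
            show α + (2 + θ) = α + θ + 2 by ring]
          apply ENNReal.ofReal_le_ofReal
          refine mul_le_mul_of_nonneg_right ?_ (by positivity)
          refine sigmaProfile_mono hμ0.le hτ (by positivity) ?_
          gcongr
          exact norm_le_norm_add_latticeVec hL0.le hz n
  calc _ ≤ ∫⁻ z in strip N k L, ENNReal.ofReal (2 * 29 ^ (2 + θ)) *
        ((∑' n : Fin k → ℤ, f (z + L • latticeVec N n)) *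
          ∑' n : Fin k → ℤ, g (z + L • latticeVec N n)) := by
        refine setLIntegral_mono' (measurableSet_strip N k L) fun z hz => ?_
        exact (mul_le_mul_right (hsource z hz) _).trans_eq (mul_left_comm _ _ _)
    _ = ENNReal.ofReal (2 * 29 ^ (2 + θ)) * ∫⁻ z in strip N k L,
        (∑' n : Fin k → ℤ, f (z + L • latticeVec N n)) *
          ∑' n : Fin k → ℤ, g (z + L • latticeVec N n) :=
        lintegral_const_mul' _ _ ENNReal.ofReal_ne_top
    _ ≤ ENNReal.ofReal (2 * 29 ^ (2 + θ)) * (2 ^ k * ∑' l : Fin k → ℤ,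
        ∫⁻ z, f z * g (z + L • latticeVec N l)) := by
        gcongr
        exact setLIntegral_strip_tsum_mul_tsum_le hkN hL0 hf hg
    _ ≤ ENNReal.ofReal (2 * 29 ^ (2 + θ)) * (2 ^ k * ∑' l : Fin k → ℤ,
        ENNReal.ofReal (C₁ * μ ^ (-2 : ℝ)) * ENNReal.ofReal
          (sigmaProfile μ τ (1 + μ * ‖y + L • latticeVec N l‖) *
            (1 + μ * ‖y + L • latticeVec N l‖) ^ (-(α + θ)))) := by
        gcongr with l
        exact h₁ μ hμ0 (L • latticeVec N l) y
    _ ≤ ENNReal.ofReal (2 * 29 ^ (2 + θ)) * (2 ^ k * (ENNReal.ofReal (C₁ * μ ^ (-2 : ℝ)) *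
        (ENNReal.ofReal (C₂ * sigmaProfile μ τ (1 + μ * ‖y‖)) *
          ∑' n : Fin k → ℤ,
            ENNReal.ofReal ((1 + μ * ‖y + L • latticeVec N n‖) ^ (-(α + θ)))))) := by
        rw [ENNReal.tsum_mul_left]
        gcongr
        exact h₂ μ L hμ hL y hy
    _ = _ := by
        have e : (2 : ENNReal) ^ k = ENNReal.ofReal (2 ^ k) := by
          rw [ENNReal.ofReal_pow (by norm_num)]; norm_num
        have hs := sigmaProfile_nonneg (τ := τ) hμ0.le (by positivity : 0 ≤ 1 + μ * ‖y‖)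
        rw [e, ← mul_assoc, ← mul_assoc, ← mul_assoc, ← ENNReal.ofReal_mul (by positivity),
          ← ENNReal.ofReal_mul (by positivity), ← ENNReal.ofReal_mul (by positivity)]
        congr 2
        ring

theorem ofReal_tsum_le_tsum_ofReal {ι : Type*} {f : ι → ℝ} (hf : ∀ i, 0 ≤ f i) :
    ENNReal.ofReal (∑' i, f i) ≤ ∑' i, ENNReal.ofReal (f i) := by
  by_cases h : Summable f
  · rw [ENNReal.ofReal_tsum_of_nonneg hf h]
  · simp [tsum_eq_zero_of_not_summable h]

theorem one_add_mul_norm_le_two_mul {N : ℕ} {μ : ℝ} (hμ : 0 ≤ μ) {x : Euc N} (hx : μ * ‖x‖ ≤ 1)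
    (v : Euc N) : 1 + μ * ‖v‖ ≤ 2 * (1 + μ * ‖v - x‖) := by
  have h := mul_le_mul_of_nonneg_left (norm_le_norm_sub_add v x) hμ
  have : 0 ≤ μ * ‖v - x‖ := by positivity
  linarith

theorem one_add_mul_norm_sub_le_two_mul {N : ℕ} {μ : ℝ} (hμ : 0 ≤ μ) {x : Euc N}
    (hx : μ * ‖x‖ ≤ 1) (v : Euc N) : 1 + μ * ‖v - x‖ ≤ 2 * (1 + μ * ‖v‖) := by
  have h := mul_le_mul_of_nonneg_left (norm_sub_le v x) hμ
  have : 0 ≤ μ * ‖v‖ := by positivity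
  linarith

theorem sub_xc {N : ℕ} (L : ℝ) (P : ℕ → Euc N) (x z : Euc N) (j : ℕ) :
    z - xc L P x j = z + L • P j - x := by
  unfold xc
  abel

theorem sphereArea_nonneg (N : ℕ) : 0 ≤ sphereArea N := by
  unfold sphereArea
  positivity

theorem Γfun_eq {N : ℕ} (y z : Euc N) :
    Γfun N y z = 1 / (((N : ℝ) - 2) * sphereArea N) * ‖y - z‖ ^ (-((N : ℝ) - 2)) := by
  rw [Γfun, Real.rpow_neg (norm_nonneg _)]
  simp only [one_div, mul_inv]

theorem Γfun_nonneg {N : ℕ} (hN : 2 ≤ N) (y z : Euc N) : 0 ≤ Γfun N y z := by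
  have h2 : (2 : ℝ) ≤ N := by exact_mod_cast hN
  have := mul_nonneg (sub_nonneg.2 h2) (sphereArea_nonneg N)
  rw [Γfun_eq]
  positivity

theorem ofReal_Green_le {N k : ℕ} (hN : 2 ≤ N) (hk : k ≤ N) {P : ℕ → Euc N}
    (hP : LatticeEnum N k P) (L : ℝ) (z y : Euc N) :
    ENNReal.ofReal (Green N L P z y) ≤ ENNReal.ofReal (1 / (((N : ℝ) - 2) * sphereArea N)) *
      ∑' n : Fin k → ℤ, ENNReal.ofReal (‖z + L • latticeVec N n - y‖ ^ (-((N : ℝ) - 2))) := by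
  refine (ofReal_tsum_le_tsum_ofReal fun j => Γfun_nonneg hN _ _).trans_eq ?_
  rw [hP.tsum_eq hk fun p => ENNReal.ofReal (Γfun N (z + L • p) y), ← ENNReal.tsum_mul_left]
  refine tsum_congr fun n => ?_
  rw [Γfun_eq, ENNReal.ofReal_mul']
  positivity

theorem Ub_nonneg {N : ℕ} (hN : 2 ≤ N) {s μ : ℝ} (hs : 0 ≤ s) (hμ : 0 ≤ μ) (x y : Euc N) :
    0 ≤ Ub N s x μ y := by
  have h2 : (0 : ℝ) ≤ (N : ℝ) - 2 := sub_nonneg.2 (by exact_mod_cast hN)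
  unfold Ub Wb
  positivity

theorem Ub_le {N : ℕ} (hN : 2 ≤ N) {s μ : ℝ} (hs : 0 ≤ s) (hμ : 0 ≤ μ) {x : Euc N}
    (hx : μ * ‖x‖ ≤ 1) (v : Euc N) :
    s * Wb N x μ v ≤ s * ((N : ℝ) * ((N : ℝ) - 2)) ^ (((N : ℝ) - 2) / 4) *
      8 ^ (((N : ℝ) - 2) / 2) * μ ^ (((N : ℝ) - 2) / 2) * (1 + μ * ‖v‖) ^ (-((N : ℝ) - 2)) := by
  have h2 : (0 : ℝ) ≤ (N : ℝ) - 2 := sub_nonneg.2 (by exact_mod_cast hN)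
  set w := 1 + μ * ‖v‖
  have hw : 0 < w := by positivity
  have hle : w ^ 2 / 8 ≤ 1 + μ ^ 2 * ‖v - x‖ ^ 2 := by
    have h1 : w ≤ 2 * (1 + μ * ‖v - x‖) := one_add_mul_norm_le_two_mul hμ hx v
    nlinarith [sq_nonneg (1 - μ * ‖v - x‖)]
  have hpow : (1 + μ ^ 2 * ‖v - x‖ ^ 2) ^ (-(((N : ℝ) - 2) / 2)) ≤
      8 ^ (((N : ℝ) - 2) / 2) * w ^ (-((N : ℝ) - 2)) := by
    calc _ ≤ (w ^ 2 / 8) ^ (-(((N : ℝ) - 2) / 2)) :=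
          Real.rpow_le_rpow_of_nonpos (by positivity) hle (by linarith)
      _ = _ := by
          rw [Real.div_rpow (by positivity) (by norm_num), ← Real.rpow_natCast w 2,
            ← Real.rpow_mul hw.le, Real.rpow_neg (by norm_num : (0 : ℝ) ≤ 8), div_inv_eq_mul,
            mul_comm]
          congr 2
          push_cast
          ring
  unfold Wb
  rw [div_eq_mul_inv, ← Real.rpow_neg (by positivity)]
  calc _ ≤ s * (((N : ℝ) * ((N : ℝ) - 2)) ^ (((N : ℝ) - 2) / 4) * μ ^ (((N : ℝ) - 2) / 2) *
        (8 ^ (((N : ℝ) - 2) / 2) * w ^ (-((N : ℝ) - 2)))) := by gcongr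
    _ = _ := by ring

theorem Ub_xc {N : ℕ} (s L μ : ℝ) (P : ℕ → Euc N) (x z : Euc N) (j : ℕ) :
    Ub N s (xc L P x j) μ z = s * Wb N x μ (z + L • P j) := by
  rw [Ub, Wb, Wb, sub_xc]

theorem exists_tsum_Ub_rpow_le {N k : ℕ} (hN : 3 ≤ N) (hk : k ≤ N) {κ θ : ℝ} (hκ : (k : ℝ) < κ)
    (hκN : κ ≤ (N : ℝ) - 2) (hθ : 2 + θ ≤ ((N : ℝ) - 2 - κ) * (4 / ((N : ℝ) - 2)))
    {s : ℝ} (hs : 0 < s) {P : ℕ → Euc N} (hP : LatticeEnum N k P) :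
    ∃ C : ℝ, 0 < C ∧ ∀ (μ L : ℝ) (x : Euc N), 1 ≤ μ → 1 ≤ L → μ * ‖x‖ ≤ 1 → ∀ z ∈ strip N k L,
      (∑' j : ℕ, Ub N s (xc L P x j) μ z) ^ (4 / ((N : ℝ) - 2)) ≤
        C * μ ^ (2 : ℝ) * (1 + μ * ‖z‖) ^ (-(2 + θ)) := by
  have h2 : (0 : ℝ) < (N : ℝ) - 2 := by
    have : (3 : ℝ) ≤ N := by exact_mod_cast hN
    linarith
  obtain ⟨Z, hZ, hsum⟩ := exists_tsum_rpow_neg_le (N := N) hk hκ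
  set B := s * ((N : ℝ) * ((N : ℝ) - 2)) ^ (((N : ℝ) - 2) / 4) * 8 ^ (((N : ℝ) - 2) / 2) with hB
  have hN0 : (0 : ℝ) < N := by linarith
  have hB0 : 0 < B := by positivity
  refine ⟨(B * Z) ^ (4 / ((N : ℝ) - 2)), by positivity, fun μ L x hμ hL hx z hz => ?_⟩
  have hμ0 : 0 < μ := by linarith
  set D := 1 + μ * ‖z‖ with hD
  have hD1 : 1 ≤ D := by
    have : 0 ≤ μ * ‖z‖ := by positivity
    linarith
  have hD0 : 0 < D := by linarith
  have hnn : ∀ j, 0 ≤ Ub N s (xc L P x j) μ z := fun j => Ub_nonneg (by lia) hs.le hμ0.le _ _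
  have hbound : ∑' j : ℕ, Ub N s (xc L P x j) μ z ≤
      B * Z * μ ^ (((N : ℝ) - 2) / 2) * D ^ (-((N : ℝ) - 2 - κ)) := by
    rw [← ENNReal.ofReal_le_ofReal_iff (by positivity)]
    refine (ofReal_tsum_le_tsum_ofReal hnn).trans ?_
    simp only [Ub_xc]
    rw [hP.tsum_eq hk fun p => ENNReal.ofReal (s * Wb N x μ (z + L • p))]
    calc _ ≤ ∑' n : Fin k → ℤ,
          ENNReal.ofReal (B * μ ^ (((N : ℝ) - 2) / 2) * D ^ (-((N : ℝ) - 2 - κ))) *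
            ENNReal.ofReal ((1 + μ * ‖z + L • latticeVec N n‖) ^ (-κ)) := by
          refine ENNReal.tsum_le_tsum fun n => ?_
          rw [← ENNReal.ofReal_mul (by positivity)]
          apply ENNReal.ofReal_le_ofReal
          refine (Ub_le (by lia) hs.le hμ0.le hx _).trans ?_
          rw [show -((N : ℝ) - 2) = -((N : ℝ) - 2 - κ) + -κ by ring,
            Real.rpow_add (by positivity), ← mul_assoc]
          refine mul_le_mul_of_nonneg_right ?_ (by positivity)
          refine mul_le_mul_of_nonneg_left ?_ (by positivity)
          refine Real.rpow_le_rpow_of_nonpos hD0 ?_ (by linarith)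
          have := mul_le_mul_of_nonneg_left
            (norm_le_norm_add_latticeVec (by linarith) hz n) hμ0.le
          linarith
      _ ≤ ENNReal.ofReal (B * μ ^ (((N : ℝ) - 2) / 2) * D ^ (-((N : ℝ) - 2 - κ))) *
            ENNReal.ofReal Z := by
          rw [ENNReal.tsum_mul_left]
          gcongr
          exact hsum μ L hμ hL z hz
      _ = _ := by
          rw [← ENNReal.ofReal_mul (by positivity)]
          congr 1
          ring
  calc _ ≤ (B * Z * μ ^ (((N : ℝ) - 2) / 2) * D ^ (-((N : ℝ) - 2 - κ))) ^ (4 / ((N : ℝ) - 2)) := by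
        exact Real.rpow_le_rpow (tsum_nonneg hnn) hbound (by positivity)
    _ = (B * Z) ^ (4 / ((N : ℝ) - 2)) * μ ^ (2 : ℝ) *
          D ^ (-(((N : ℝ) - 2 - κ) * (4 / ((N : ℝ) - 2)))) := by
        rw [Real.mul_rpow (by positivity) (by positivity),
          Real.mul_rpow (by positivity) (by positivity), ← Real.rpow_mul hμ0.le,
          ← Real.rpow_mul hD0.le, neg_mul]
        congr 3
        field_simp
        norm_num
    _ ≤ _ := by
        gcongr

theorem ofReal_wStar_le {N k : ℕ} (hk : k ≤ N) {P : ℕ → Euc N} (hP : LatticeEnum N k P)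
    {μ L τ : ℝ} (hμ : 1 ≤ μ) (hτ : 1 ≤ τ) (hα : 0 ≤ ((N : ℝ) - 2) / 2 + τ) {x : Euc N}
    (hx : μ * ‖x‖ ≤ 1) (z : Euc N) :
    ENNReal.ofReal (wStar N L P x μ τ z) ≤
      ENNReal.ofReal (2 ^ (τ - 1) * μ ^ (((N : ℝ) - 2) / 2) * 2 ^ (((N : ℝ) - 2) / 2 + τ)) *
        (ENNReal.ofReal (sigmaProfile μ τ (1 + μ * ‖z‖)) *
          ∑' n : Fin k → ℤ, ENNReal.ofReal
            ((1 + μ * ‖z + L • latticeVec N n‖) ^ (-(((N : ℝ) - 2) / 2 + τ)))) := by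
  have hμ0 : 0 < μ := by linarith
  set α := ((N : ℝ) - 2) / 2 + τ
  have hσ0 : 0 ≤ sigmaProfile μ τ (1 + μ * ‖z‖) := sigmaProfile_nonneg hμ0.le (by positivity)
  have hσ : σw x μ τ z ≤ 2 ^ (τ - 1) * sigmaProfile μ τ (1 + μ * ‖z‖) :=
    (sigmaProfile_mono hμ0.le hτ (by positivity)
      (one_add_mul_norm_sub_le_two_mul hμ0.le hx z)).trans
      (sigmaProfile_two_mul_le hμ0.le hτ (by positivity))
  unfold wStar
  have hs0 : 0 ≤ ∑' j : ℕ, μ ^ (((N : ℝ) - 2) / 2) / (1 + μ * ‖z - xc L P x j‖) ^ α :=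
    tsum_nonneg fun j => by positivity
  rw [ENNReal.ofReal_mul' hs0]
  calc _ ≤ ENNReal.ofReal (2 ^ (τ - 1) * sigmaProfile μ τ (1 + μ * ‖z‖)) *
        ∑' n : Fin k → ℤ, ENNReal.ofReal (μ ^ (((N : ℝ) - 2) / 2) * 2 ^ α) *
          ENNReal.ofReal ((1 + μ * ‖z + L • latticeVec N n‖) ^ (-α)) := by
        gcongr
        refine (ofReal_tsum_le_tsum_ofReal fun j => by positivity).trans ?_
        simp only [sub_xc]
        rw [hP.tsum_eq hk fun p => ENNReal.ofReal
          (μ ^ (((N : ℝ) - 2) / 2) / (1 + μ * ‖z + L • p - x‖) ^ α)]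
        refine ENNReal.tsum_le_tsum fun n => ?_
        rw [← ENNReal.ofReal_mul (by positivity)]
        apply ENNReal.ofReal_le_ofReal
        set v := z + L • latticeVec N n
        rw [div_eq_mul_inv, ← Real.rpow_neg (by positivity), mul_assoc]
        refine mul_le_mul_of_nonneg_left ?_ (by positivity)
        calc _ ≤ (1 / 2 * (1 + μ * ‖v‖)) ^ (-α) := by
              refine Real.rpow_le_rpow_of_nonpos (by positivity) ?_ (by linarith)
              linarith [one_add_mul_norm_le_two_mul hμ0.le hx v]
          _ = _ := by
              rw [Real.mul_rpow (by norm_num) (by positivity), one_div,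
                Real.inv_rpow (by norm_num), Real.rpow_neg (by norm_num), inv_inv]
    _ = _ := by
        rw [ENNReal.tsum_mul_left, ← mul_assoc, ← mul_assoc, ← ENNReal.ofReal_mul (by positivity),
          ← ENNReal.ofReal_mul (by positivity)]
        congr 2
        ring

theorem tsum_ofReal_le_ofReal_tsum_xc {N k : ℕ} (hk : k ≤ N) {P : ℕ → Euc N}
    (hP : LatticeEnum N k P) {γ : ℝ} (hγ : (k : ℝ) < γ) {μ L : ℝ} (hμ : 1 ≤ μ) (hL : 1 ≤ L)
    {x : Euc N} (hx : μ * ‖x‖ ≤ 1) {y : Euc N} (hy : y ∈ strip N k L) {m : ℝ} (hm : 0 ≤ m) :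
    ENNReal.ofReal m *
        ∑' n : Fin k → ℤ, ENNReal.ofReal ((1 + μ * ‖y + L • latticeVec N n‖) ^ (-γ)) ≤
      ENNReal.ofReal (2 ^ γ * ∑' j : ℕ, m / (1 + μ * ‖y - xc L P x j‖) ^ γ) := by
  have hμ0 : 0 < μ := by linarith
  have hγ0 : 0 < γ := lt_of_le_of_lt (Nat.cast_nonneg _) hγ
  obtain ⟨Z, hZ, hsum⟩ := exists_tsum_rpow_neg_le (N := N) hk hγ
  have hS := hsum μ L hμ hL y hy
  have hnn : ∀ j, 0 ≤ m / (1 + μ * ‖y - xc L P x j‖) ^ γ := fun j => by positivity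
  have hsummable : Summable fun j : ℕ => m / (1 + μ * ‖y - xc L P x j‖) ^ γ := by
    have hle : ∀ j, m / (1 + μ * ‖y - xc L P x j‖) ^ γ ≤
        m * 2 ^ γ * (1 + μ * ‖y + L • P j‖) ^ (-γ) := by
      intro j
      rw [sub_xc, div_eq_mul_inv, mul_assoc]
      refine mul_le_mul_of_nonneg_left ?_ hm
      rw [Real.rpow_neg (by positivity), ← div_eq_mul_inv, inv_le_comm₀ (by positivity)
        (by positivity), inv_div, ← Real.div_rpow (by positivity) (by norm_num)]
      refine Real.rpow_le_rpow (by positivity) ?_ hγ0.le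
      linarith [one_add_mul_norm_le_two_mul hμ0.le hx (y + L • P j)]
    refine Summable.of_nonneg_of_le hnn hle (Summable.mul_left _ ?_)
    have hne : ∑' j : ℕ, ENNReal.ofReal ((1 + μ * ‖y + L • P j‖) ^ (-γ)) ≠ ⊤ := by
      rw [hP.tsum_eq hk fun p => ENNReal.ofReal ((1 + μ * ‖y + L • p‖) ^ (-γ))]
      exact ne_top_of_le_ne_top ENNReal.ofReal_ne_top hS
    refine (ENNReal.summable_toReal hne).congr fun j => ?_
    rw [ENNReal.toReal_ofReal (by positivity)]
  rw [ENNReal.ofReal_mul (by positivity), ENNReal.ofReal_tsum_of_nonneg hnn hsummable,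
    ← ENNReal.tsum_mul_left, ← ENNReal.tsum_mul_left]
  simp only [sub_xc]
  rw [hP.tsum_eq hk fun p => ENNReal.ofReal (2 ^ γ) *
    ENNReal.ofReal (m / (1 + μ * ‖y + L • p - x‖) ^ γ)]
  refine ENNReal.tsum_le_tsum fun n => ?_
  rw [← ENNReal.ofReal_mul hm, ← ENNReal.ofReal_mul (by positivity)]
  apply ENNReal.ofReal_le_ofReal
  rw [Real.rpow_neg (by positivity), mul_div_left_comm]
  refine mul_le_mul_of_nonneg_left ?_ hm
  rw [inv_le_comm₀ (by positivity) (by positivity), inv_div,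
    ← Real.div_rpow (by positivity) (by norm_num)]
  refine Real.rpow_le_rpow (by positivity) ?_ hγ0.le
  linarith [one_add_mul_norm_sub_le_two_mul hμ0.le hx (y + L • latticeVec N n)]

theorem integral_le_of_lintegral_ofReal_le {X : Type*} [MeasurableSpace X] {ν : Measure X}
    {F : X → ℝ} (hF : ∀ z, 0 ≤ F z) {R : ℝ} (hR : 0 ≤ R)
    (h : ∫⁻ z, ENNReal.ofReal (F z) ∂ν ≤ ENNReal.ofReal R) : ∫ z, F z ∂ν ≤ R := by
  by_cases hi : Integrable F ν
  · rw [← ENNReal.ofReal_le_ofReal_iff hR,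
      ofReal_integral_eq_lintegral_ofReal hi (Filter.Eventually.of_forall hF)]
    exact h
  · rwa [integral_undef hi]

theorem exists_integral_Green_mul_le {N k : ℕ} (hN : 3 ≤ N) (hk1 : 1 ≤ k) (hkN : k ≤ N)
    {s : ℝ} (hs : 0 < s) {P : ℕ → Euc N} (hP : LatticeEnum N k P) {τ θ κ : ℝ}
    (hκ : (k : ℝ) < κ) (hκN : κ ≤ (N : ℝ) - 2)
    (hκθ : 2 + θ ≤ ((N : ℝ) - 2 - κ) * (4 / ((N : ℝ) - 2))) (hθ : 0 ≤ θ) (hτ : 1 ≤ τ)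
    (hα : 2 * (k : ℝ) ≤ ((N : ℝ) - 2) / 2 + τ)
    (hαN : ((N : ℝ) - 2) / 2 + τ + θ < (N : ℝ) - 2) :
    ∃ C : ℝ, 0 < C ∧ ∀ (μ L : ℝ) (x : Euc N), 1 ≤ μ → 1 ≤ L → μ * ‖x‖ ≤ 1 → ∀ y ∈ strip N k L,
      (∫ z in strip N k L, Green N L P z y *
          (∑' j : ℕ, Ub N s (xc L P x j) μ z) ^ (4 / ((N : ℝ) - 2)) * wStar N L P x μ τ z) ≤
        C * σw x μ τ y * ∑' j : ℕ, μ ^ (((N : ℝ) - 2) / 2) /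
          (1 + μ * ‖y - xc L P x j‖) ^ (((N : ℝ) - 2) / 2 + τ + θ) := by
  have hk1' : (1 : ℝ) ≤ k := by exact_mod_cast hk1
  have h2 : (0 : ℝ) < (N : ℝ) - 2 := by
    have : (3 : ℝ) ≤ N := by exact_mod_cast hN
    linarith
  obtain ⟨C₁, hC₁, h₁⟩ := exists_tsum_Ub_rpow_le hN hkN hκ hκN hκθ hs hP
  obtain ⟨C₂, hC₂, h₂⟩ := exists_setLIntegral_strip_le hN hk1 hkN hα hθ hτ (by linarith) hαN
  have hA := mul_nonneg h2.le (sphereArea_nonneg N)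
  set a := ((N : ℝ) - 2) / 2 with ha
  set c := 1 / (((N : ℝ) - 2) * sphereArea N) with hc
  have hc0 : 0 ≤ c := by positivity
  refine ⟨(c + 1) * C₁ * (2 ^ (τ - 1) * 2 ^ (a + τ)) * C₂ * 2 ^ (τ - 1) * 2 ^ (a + τ + θ),
    by positivity, fun μ L x hμ hL hx y hy => ?_⟩
  have hμ0 : 0 < μ := by linarith
  have hσ0 : ∀ v, 0 ≤ σw x μ τ v := fun v => sigmaProfile_nonneg hμ0.le (by positivity)
  have hUb : ∀ z, 0 ≤ (∑' j : ℕ, Ub N s (xc L P x j) μ z) ^ (4 / ((N : ℝ) - 2)) := fun z =>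
    Real.rpow_nonneg (tsum_nonneg fun j => Ub_nonneg (by lia) hs.le hμ0.le _ _) _
  have hG : ∀ z, 0 ≤ Green N L P z y := fun z => tsum_nonneg fun j => Γfun_nonneg (by lia) _ _
  have hw : ∀ z, 0 ≤ wStar N L P x μ τ z := fun z =>
    mul_nonneg (hσ0 z) (tsum_nonneg fun j => by positivity)
  have hT : 0 ≤ ∑' j : ℕ, μ ^ a / (1 + μ * ‖y - xc L P x j‖) ^ (a + τ + θ) :=
    tsum_nonneg fun j => by positivity
  have hσy := hσ0 y
  refine integral_le_of_lintegral_ofReal_le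
    (fun z => mul_nonneg (mul_nonneg (hG z) (hUb z)) (hw z)) (by positivity) ?_
  have hσp0 : 0 ≤ sigmaProfile μ τ (1 + μ * ‖y‖) := sigmaProfile_nonneg hμ0.le (by positivity)
  have hσp : sigmaProfile μ τ (1 + μ * ‖y‖) ≤ 2 ^ (τ - 1) * σw x μ τ y :=
    (sigmaProfile_mono hμ0.le hτ (by positivity)
      (one_add_mul_norm_le_two_mul hμ0.le hx y)).trans
      (sigmaProfile_two_mul_le hμ0.le hτ (by positivity))
  set M := C₁ * μ ^ (2 : ℝ) * (2 ^ (τ - 1) * μ ^ a * 2 ^ (a + τ)) with hM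
  have hM0 : 0 ≤ M := by positivity
  calc _ ≤ ∫⁻ z in strip N k L, ENNReal.ofReal (c * M) *
        ((∑' n : Fin k → ℤ, ENNReal.ofReal (‖z + L • latticeVec N n - y‖ ^ (-((N : ℝ) - 2)))) *
        (ENNReal.ofReal (sigmaProfile μ τ (1 + μ * ‖z‖)) *
          (ENNReal.ofReal ((1 + μ * ‖z‖) ^ (-(2 + θ))) * ∑' n : Fin k → ℤ,
            ENNReal.ofReal ((1 + μ * ‖z + L • latticeVec N n‖) ^ (-(a + τ)))))) := by
        refine setLIntegral_mono' (measurableSet_strip N k L) fun z hz => ?_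
        rw [ENNReal.ofReal_mul (mul_nonneg (hG z) (hUb z)), ENNReal.ofReal_mul (hG z)]
        refine (mul_le_mul' (mul_le_mul' (ofReal_Green_le (by lia) hkN hP L z y)
          (ENNReal.ofReal_le_ofReal (h₁ μ L x hμ hL hx z hz)))
          (ofReal_wStar_le hkN hP hμ hτ (by linarith) hx z)).trans_eq ?_
        rw [ENNReal.ofReal_mul (by positivity : 0 ≤ C₁ * μ ^ (2 : ℝ)), ENNReal.ofReal_mul hc0,
          hM, ENNReal.ofReal_mul (by positivity : 0 ≤ C₁ * μ ^ (2 : ℝ))]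
        ring
    _ ≤ ENNReal.ofReal (c * M) * (ENNReal.ofReal
          (C₂ * μ ^ (-2 : ℝ) * sigmaProfile μ τ (1 + μ * ‖y‖)) *
        ∑' n : Fin k → ℤ,
          ENNReal.ofReal ((1 + μ * ‖y + L • latticeVec N n‖) ^ (-(a + τ + θ)))) := by
        rw [lintegral_const_mul' _ _ ENNReal.ofReal_ne_top]
        gcongr
        exact h₂ μ L hμ hL y hy
    _ ≤ ENNReal.ofReal ((c + 1) * C₁ * (2 ^ (τ - 1) * 2 ^ (a + τ)) * C₂ * 2 ^ (τ - 1) *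
          σw x μ τ y) * (ENNReal.ofReal (μ ^ a) * ∑' n : Fin k → ℤ,
          ENNReal.ofReal ((1 + μ * ‖y + L • latticeVec N n‖) ^ (-(a + τ + θ)))) := by
        rw [← mul_assoc (ENNReal.ofReal (c * M)), ← mul_assoc _ (ENNReal.ofReal (μ ^ a)),
          ← ENNReal.ofReal_mul (by positivity), ← ENNReal.ofReal_mul (by positivity)]
        refine mul_le_mul_left (ENNReal.ofReal_le_ofReal ?_) _
        have hμ2 : μ ^ (2 : ℝ) * μ ^ (-2 : ℝ) = 1 := by
          rw [← Real.rpow_add hμ0]; norm_num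
        calc _ = c * C₁ * (2 ^ (τ - 1) * 2 ^ (a + τ)) * C₂ * μ ^ a *
              (μ ^ (2 : ℝ) * μ ^ (-2 : ℝ)) * sigmaProfile μ τ (1 + μ * ‖y‖) := by
              rw [hM]; ring
          _ ≤ (c + 1) * C₁ * (2 ^ (τ - 1) * 2 ^ (a + τ)) * C₂ * μ ^ a *
              (2 ^ (τ - 1) * σw x μ τ y) := by
              rw [hμ2, mul_one]
              gcongr
              linarith
          _ = _ := by ring
    _ ≤ ENNReal.ofReal ((c + 1) * C₁ * (2 ^ (τ - 1) * 2 ^ (a + τ)) * C₂ * 2 ^ (τ - 1) *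
          σw x μ τ y) * ENNReal.ofReal (2 ^ (a + τ + θ) * ∑' j : ℕ, μ ^ a /
            (1 + μ * ‖y - xc L P x j‖) ^ (a + τ + θ)) := by
        gcongr
        exact tsum_ofReal_le_ofReal_tsum_xc hkN hP (by linarith) hμ hL hx hy (by positivity)
    _ = _ := by
        rw [← ENNReal.ofReal_mul (by positivity)]
        congr 1
        ring

theorem Admissible.mul_norm_le_one {N : ℕ} {θ C0 β L μ : ℝ} {x : Euc N} (hθ : 0 ≤ θ)
    (h : Admissible N θ C0 β L x μ) : μ * ‖x‖ ≤ 1 := by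
  have hμ : 0 < μ := by linarith [h.1]
  calc μ * ‖x‖ ≤ μ * μ ^ (-(1 + θ)) := by gcongr; exact h.2.2.1
    _ = μ ^ (-θ) := by
        rw [show -(1 + θ) = -1 + -θ by ring, Real.rpow_add hμ, Real.rpow_neg_one]
        field_simp
    _ ≤ 1 := Real.rpow_le_one_of_one_le_of_nonpos h.1 (by linarith)

/-- Lemma 3.4, the key weighted Green's function estimate. -/
theorem lemma3_4
    (N k : ℕ) (hN : 5 ≤ N) (hk1 : 1 ≤ k) (hk2 : (k : ℝ) < ((N : ℝ) - 2) / 2)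
    (s : ℝ) (hs : 0 < s)
    (P : ℕ → Euc N) (hP : LatticeEnum N k P)
    (τ : ℝ) (hτk : (k : ℝ) < τ) (hτN : τ < ((N : ℝ) - 2) / 2)
    (θa C0 β : ℝ) (hθa : 0 < θa) (hC0 : 0 < C0)
    (hβ1 : (N : ℝ) - 2 < β) (hβ2 : β < (N : ℝ)) :
    ∃ θ : ℝ, 0 < θ ∧ ∃ C : ℝ, 0 < C ∧ ∀ ε : ℝ, 0 < ε → ε < 1 → ∃ Cε : ℝ, 0 < Cε ∧
      ∀ (L : ℝ) (x : Euc N) (μ : ℝ), Admissible N θa C0 β L x μ →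
        ∀ y ∈ strip N k L,
          (∫ z in strip N k L, Green N L P z y *
              (∑' j : ℕ, Ub N s (xc L P x j) μ z) ^ (4 / ((N : ℝ) - 2)) *
              wStar N L P x μ τ z) ≤
            Cε * σw x μ τ y *
              (∑' j : ℕ, μ ^ (((N : ℝ) - 2) / 2) /
                (1 + μ * ‖y - xc L P x j‖) ^ (((N : ℝ) - 2) / 2 + τ + θ)) +
            C * ε ^ (2 - 4 * τ / ((N : ℝ) - 2)) / μ ^ (2 - 4 * τ / ((N : ℝ) - 2)) *
              wStar N L P x μ τ y := by
  have hk1' : (1 : ℝ) ≤ k := by exact_mod_cast hk1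
  have h2 : (0 : ℝ) < (N : ℝ) - 2 := by linarith
  have hkN : k ≤ N := by
    have : (k : ℝ) ≤ N := by linarith
    exact_mod_cast this
  obtain ⟨κ, hκ, hκN⟩ := exists_between hk2
  have hgap : 0 < ((N : ℝ) - 2 - κ) * (4 / ((N : ℝ) - 2)) - 2 := by
    rw [sub_pos, ← mul_div_assoc, lt_div_iff₀ h2]
    linarith
  obtain ⟨θ, hθ, hθlt⟩ := exists_between (lt_min hgap (sub_pos.2 hτN))
  have hθ₁ := hθlt.trans_le (min_le_left _ _)
  have hθ₂ := hθlt.trans_le (min_le_right _ _)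
  obtain ⟨C, hC, h⟩ := exists_integral_Green_mul_le (by lia) hk1 hkN hs hP (τ := τ) (θ := θ)
    hκ (by linarith) (by linarith) hθ.le (by linarith) (by linarith) (by linarith)
  refine ⟨θ, hθ, 1, one_pos, fun ε hε _ => ⟨C, hC, fun L x μ hadm y hy => ?_⟩⟩
  have hμ : 0 < μ := by linarith [hadm.1]
  refine (h μ L x hadm.1 hadm.2.1 (hadm.mul_norm_le_one hθa.le) y hy).trans
    (le_add_of_nonneg_right ?_)
  have hw : 0 ≤ wStar N L P x μ τ y :=
    mul_nonneg (sigmaProfile_nonneg hμ.le (by positivity)) (tsum_nonneg fun j => by positivity)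
  positivity

end PeriodicCriticalSystem
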